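/- arXiv:2505.21737 — 9 statements merged into one kernel-verified Lean document; each statement's English description precedes it below -/
import Mathlib

section
/- Let a, b be integers with a < b, let c ∈ (0,1), and let g : [a,b] → ℝ be a decreasing concave function which is c-Lipschitz on [a,b] and satisfies ⌊g(a)⌋ > ⌊g(a+1)⌋. Then T(g,a,b) ≤ ∫_a^b g(z) dz − (1−c)(b−a)/2. -/
open Real Set

/-- The trapezoidal floor sum of `g` on `[a,b]`. -/
noncomputable def trapSum (g : ℝ → ℝ) (a b : ℤ) : ℝ :=
  (⌊g a⌋ : ℝ) / 2 + ∑ m ∈ Finset.Ioo a b, (⌊g m⌋ : ℝ) + (⌊g b⌋ : ℝ) / 2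

/-- `g` is `c`-Lipschitz on the set `s`. -/
def LipschitzWithConstOn (c : ℝ) (g : ℝ → ℝ) (s : Set ℝ) : Prop :=
  ∀ z ∈ s, ∀ w ∈ s, |g z - g w| ≤ c * |z - w|

/-- The lower half of the Hermite–Hadamard inequality for concave functions. -/
theorem ConcaveOn.mul_add_div_two_le_integral {g : ℝ → ℝ} {p q : ℝ} (hpq : p ≤ q)
    (hg : ConcaveOn ℝ (Set.Icc p q) g) (hint : IntervalIntegrable g MeasureTheory.volume p q) :
    (q - p) * (g p + g q) / 2 ≤ ∫ z in p..q, g z := by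
  rcases hpq.eq_or_lt with rfl | hlt
  · simp
  have hqp : 0 < q - p := sub_pos.2 hlt
  have hne : q - p ≠ 0 := hqp.ne'
  set s := (g q - g p) / (q - p) with hs
  have hchord : ∫ z in p..q, (g p + s * (z - p)) = (q - p) * (g p + g q) / 2 := by
    rw [intervalIntegral.integral_add intervalIntegrable_const
      (Continuous.intervalIntegrable (by fun_prop) _ _), intervalIntegral.integral_const_mul,
      intervalIntegral.integral_sub intervalIntegral.intervalIntegrable_id
        intervalIntegrable_const, integral_id]
    simp only [intervalIntegral.integral_const, smul_eq_mul, hs]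
    field_simp
    ring
  rw [← hchord]
  refine intervalIntegral.integral_mono_on hpq
    (Continuous.intervalIntegrable (by fun_prop) _ _) hint fun z hz => ?_
  have h := hg.2 (Set.left_mem_Icc.2 hpq) (Set.right_mem_Icc.2 hpq)
    (show 0 ≤ (q - z) / (q - p) from div_nonneg (sub_nonneg.2 hz.2) hqp.le)
    (show 0 ≤ (z - p) / (q - p) from div_nonneg (sub_nonneg.2 hz.1) hqp.le)
    (by field_simp; ring)
  simp only [smul_eq_mul] at h
  have hcomb : (q - z) / (q - p) * p + (z - p) / (q - p) * q = z := by field_simp; ring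
  have hval : (q - z) / (q - p) * g p + (z - p) / (q - p) * g q = g p + s * (z - p) := by
    rw [hs]; field_simp; ring
  rwa [hcomb, hval] at h

theorem trapSum_succ_self (g : ℝ → ℝ) (a : ℤ) :
    trapSum g a (a + 1) = ((⌊g a⌋ : ℝ) + ⌊g (a + 1 : ℤ)⌋) / 2 := by
  have h : Finset.Ioo a (a + 1) = ∅ := by ext; simp
  rw [trapSum, h, Finset.sum_empty]
  ring

theorem trapSum_succ_right (g : ℝ → ℝ) {a n : ℤ} (h : a < n) :
    trapSum g a (n + 1) = trapSum g a n + ((⌊g n⌋ : ℝ) + ⌊g (n + 1 : ℤ)⌋) / 2 := by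
  have hIoo : Finset.Ioo a (n + 1) = insert n (Finset.Ioo a n) := by ext; simp; omega
  rw [trapSum, trapSum, hIoo, Finset.sum_insert (by simp)]
  ring

theorem trapSum_le_of_concave_lipschitz (a b : ℤ) (hab : a < b) (c : ℝ)
    (hc0 : 0 < c) (hc1 : c < 1) (g : ℝ → ℝ)
    (hdec : AntitoneOn g (Set.Icc (a : ℝ) b))
    (hconc : ConcaveOn ℝ (Set.Icc (a : ℝ) b) g)
    (hlip : LipschitzWithConstOn c g (Set.Icc (a : ℝ) b))
    (hfloor : ⌊g (a + 1 : ℤ)⌋ < ⌊g a⌋) :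
    trapSum g a b ≤ (∫ z in (a : ℝ)..b, g z) - (1 - c) * (b - a) / 2 := by
  have hmem : ∀ {n : ℤ}, a ≤ n → n ≤ b → (n : ℝ) ∈ Set.Icc (a : ℝ) b := fun h₁ h₂ =>
    ⟨Int.cast_le.2 h₁, Int.cast_le.2 h₂⟩
  have hint : ∀ {p q : ℤ}, a ≤ p → p ≤ q → q ≤ b →
      IntervalIntegrable g MeasureTheory.volume p q := fun {p q} hp hpq hq => by
    refine AntitoneOn.intervalIntegrable (hdec.mono ?_)
    rw [Set.uIcc_of_le (Int.cast_le.2 hpq)]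
    exact Set.Icc_subset_Icc (Int.cast_le.2 hp) (Int.cast_le.2 hq)
  have htrap : ∀ {p q : ℤ}, a ≤ p → p ≤ q → q ≤ b →
      ((q : ℝ) - p) * (g p + g q) / 2 ≤ ∫ z in (p : ℝ)..q, g z := fun hp hpq hq =>
    (hconc.subset (Set.Icc_subset_Icc (Int.cast_le.2 hp) (Int.cast_le.2 hq))
      (convex_Icc _ _)).mul_add_div_two_le_integral (Int.cast_le.2 hpq) (hint hp hpq hq)
  have hadd : ∀ {p q : ℤ}, a ≤ p → p ≤ q → q ≤ b →
      (∫ z in (a : ℝ)..p, g z) + ∫ z in (p : ℝ)..q, g z = ∫ z in (a : ℝ)..q, g z :=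
    fun hp hpq hq => intervalIntegral.integral_add_adjacent_intervals
      (hint le_rfl hp (hpq.trans hq)) (hint hp hpq hq)
  -- A unit step across which the floor drops.
  have hdrop : ∀ {n : ℤ}, a ≤ n → n + 1 ≤ b → ⌊g (n + 1 : ℤ)⌋ < ⌊g n⌋ →
      (⌊g (n + 1 : ℤ)⌋ : ℝ) + 1 - c ≤ g (n + 1 : ℤ) ∧
      ((⌊g n⌋ : ℝ) + ⌊g (n + 1 : ℤ)⌋) / 2 ≤
        (∫ z in (n : ℝ)..(n + 1 : ℤ), g z) - (1 - c) / 2 := fun {n} hn hnb hlt => by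
    have hL := hlip n (hmem hn (by omega)) (n + 1 : ℤ) (hmem (by omega) hnb)
    have hT := htrap hn (by omega : n ≤ n + 1) hnb
    have habs : |(n : ℝ) - (n + 1 : ℤ)| = 1 := by push_cast; simp
    rw [habs, mul_one] at hL
    have hL' := (abs_le.1 hL).2
    have hcast : (((n + 1 : ℤ) : ℝ) - n) = 1 := by push_cast; ring
    rw [hcast, one_mul] at hT
    have hf : (⌊g (n + 1 : ℤ)⌋ : ℝ) + 1 ≤ ⌊g n⌋ := by exact_mod_cast hlt
    have h₁ := Int.floor_le (g n)
    have h₂ := Int.lt_floor_add_one (g (n + 1 : ℤ))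
    exact ⟨by linarith, by linarith⟩
  have bound : ∀ {n p : ℤ}, a < p → p ≤ n → n ≤ b → ⌊g p⌋ = ⌊g n⌋ →
      (⌊g p⌋ : ℝ) + 1 - c ≤ g p →
      trapSum g a n ≤ (∫ z in (a : ℝ)..p, g z) - (1 - c) * (p - a) / 2 +
        ⌊g p⌋ * ((n : ℝ) - p) →
      trapSum g a n ≤ (∫ z in (a : ℝ)..n, g z) - (1 - c) * (n - a) / 2 :=
    fun {n p} hap hpn hnb hfl hp hS => by
    have hT := htrap hap.le hpn hnb
    have hn : (⌊g p⌋ : ℝ) ≤ g n := hfl ▸ Int.floor_le (g n)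
    have hlen : (0 : ℝ) ≤ (n : ℝ) - p := sub_nonneg.2 (Int.cast_le.2 hpn)
    have hmul := mul_le_mul_of_nonneg_left
      (by linarith : 2 * (⌊g p⌋ : ℝ) + 1 - c ≤ g p + g n) hlen
    rw [← hadd hap.le hpn hnb]
    linarith
  -- `p` is the position just after the last drop of the floor.
  have key : ∀ n : ℤ, a + 1 ≤ n → n ≤ b → ∃ p : ℤ, a < p ∧ p ≤ n ∧ ⌊g p⌋ = ⌊g n⌋ ∧
      (⌊g p⌋ : ℝ) + 1 - c ≤ g p ∧
      trapSum g a n ≤ (∫ z in (a : ℝ)..p, g z) - (1 - c) * (p - a) / 2 +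
        ⌊g p⌋ * ((n : ℝ) - p) := by
    intro n hn
    induction n, hn using Int.leInduction with
    | base =>
      intro hb
      obtain ⟨h₁, h₂⟩ := hdrop le_rfl hb hfloor
      refine ⟨a + 1, by omega, le_rfl, rfl, h₁, ?_⟩
      rw [trapSum_succ_self]
      push_cast at h₂ ⊢
      linarith
    | succ n hn ih =>
      intro hb
      obtain ⟨p, hap, hpn, hfl, hp, hS⟩ := ih (by omega)
      have hle : ⌊g (n + 1 : ℤ)⌋ ≤ ⌊g n⌋ := Int.floor_mono <|
        hdec (hmem (by omega) (by omega)) (hmem (by omega) hb) (Int.cast_le.2 (by omega))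
      rcases hle.eq_or_lt with heq | hlt
      · refine ⟨p, hap, by omega, hfl.trans heq.symm, hp, ?_⟩
        rw [trapSum_succ_right g (by omega), heq, ← hfl]
        push_cast
        linarith
      · obtain ⟨h₁, h₂⟩ := hdrop (by omega) hb hlt
        have hB := bound hap hpn (by omega) hfl hp hS
        refine ⟨n + 1, by omega, le_rfl, rfl, h₁, ?_⟩
        rw [trapSum_succ_right g (by omega),
          ← hadd (by omega : a ≤ n) (by omega : n ≤ n + 1) hb]
        push_cast at h₂ ⊢
        linarith
  obtain ⟨p, hap, hpb, hfl, hp, hS⟩ := key b hab le_rfl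
  exact bound hap hpb le_rfl hfl hp hS
end

section
/- Let a, b be integers with a < b, and let g : [a,b] → ℝ be non-negative, decreasing, convex, and (1/2)-Lipschitz on [a,b], with g(b) an integer. Then T(g + 1/4, a, b) ≤ ∫_a^b g(z) dz; moreover, if equality holds then g is constant on [a,b]. -/
open Real Set

theorem LipschitzWithConstOn.continuousOn {c : ℝ} {g : ℝ → ℝ} {s : Set ℝ}
    (hg : LipschitzWithConstOn c g s) : ContinuousOn g s := by
  refine (LipschitzOnWith.of_dist_le_mul (K := c.toNNReal) fun z hz w hw => ?_).continuousOn
  rw [Real.dist_eq, Real.dist_eq]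
  exact (hg z hz w hw).trans
    (mul_le_mul_of_nonneg_right (Real.le_coe_toNNReal c) (abs_nonneg _))

theorem ConvexOn.exists_slope_le_of_lipschitzWithConstOn {c a b x : ℝ} {g : ℝ → ℝ}
    (hconv : ConvexOn ℝ (Icc a b) g) (hlip : LipschitzWithConstOn c g (Icc a b))
    (hx : x ∈ Ico a b) :
    ∃ s, (g x - g b) / (b - x) ≤ s ∧ s ≤ c ∧ ∀ z ∈ Icc a b, g x - s * (z - x) ≤ g z := by
  obtain ⟨hax, hxb⟩ := hx
  have hx' : x ∈ Icc a b := ⟨hax, hxb.le⟩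
  set S : Set ℝ := (fun w => (g x - g w) / (w - x)) '' Ioc x b with hS
  have hne : S.Nonempty := ⟨_, b, ⟨hxb, le_rfl⟩, rfl⟩
  have hle : ∀ r ∈ S, r ≤ c := by
    rintro _ ⟨w, ⟨hw1, hw2⟩, rfl⟩
    have h := hlip x hx' w ⟨hax.trans hw1.le, hw2⟩
    rw [abs_sub_comm x w, abs_of_pos (sub_pos.2 hw1)] at h
    exact (div_le_iff₀ (sub_pos.2 hw1)).2 ((le_abs_self _).trans h)
  have hbdd : BddAbove S := ⟨c, hle⟩
  refine ⟨sSup S, le_csSup hbdd ⟨b, ⟨hxb, le_rfl⟩, rfl⟩, csSup_le hne hle, fun z hz => ?_⟩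
  rcases lt_trichotomy z x with h | rfl | h
  · have : sSup S ≤ (g z - g x) / (x - z) := by
      refine csSup_le hne ?_
      rintro _ ⟨w, ⟨hw1, hw2⟩, rfl⟩
      have := hconv.slope_mono_adjacent hz ⟨hax.trans hw1.le, hw2⟩ h hw1
      rw [← neg_sub (g z), ← neg_sub (g x) (g w), neg_div, neg_div] at this
      exact neg_le_neg_iff.1 this
    rw [le_div_iff₀ (sub_pos.2 h)] at this
    linarith
  · simp
  · have : (g x - g z) / (z - x) ≤ sSup S := le_csSup hbdd ⟨z, ⟨h, hz.2⟩, rfl⟩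
    rw [div_le_iff₀ (sub_pos.2 h)] at this
    linarith

theorem integral_const_sub_mul_sub (p s x c d : ℝ) :
    ∫ z in c..d, (p - s * (z - x)) = p * (d - c) - s * ((d - x) ^ 2 - (c - x) ^ 2) / 2 := by
  rw [intervalIntegral.integral_eq_sub_of_hasDerivAt
    (f := fun z => p * z - s * (z - x) ^ 2 / 2)]
  · ring
  · intro z _
    have h := ((hasDerivAt_id z).const_mul p).sub
      (((((hasDerivAt_id z).sub_const x).pow 2).const_mul s).div_const 2)
    refine h.congr_deriv ?_
    simp only [id]
    ring
  · exact Continuous.intervalIntegrable (by fun_prop) _ _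

theorem ContinuousOn.intervalIntegrable_min_one {a b c d : ℝ} {g : ℝ → ℝ}
    (hcont : ContinuousOn g (Icc a b)) (hac : a ≤ c) (hcd : c ≤ d) (hdb : d ≤ b) :
    IntervalIntegrable (fun z => min (g z) 1) MeasureTheory.volume c d :=
  ContinuousOn.intervalIntegrable_of_Icc hcd
    ((hcont.mono (Icc_subset_Icc hac hdb)).inf continuousOn_const)

theorem le_integral_min_one_of_linear_le {a b c d p s x : ℝ} {g : ℝ → ℝ}
    (hcont : ContinuousOn g (Icc a b)) (hac : a ≤ c) (hcd : c ≤ d) (hdb : d ≤ b)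
    (hle : ∀ z ∈ Icc c d, p - s * (z - x) ≤ min (g z) 1) :
    p * (d - c) - s * ((d - x) ^ 2 - (c - x) ^ 2) / 2 ≤ ∫ z in c..d, min (g z) 1 := by
  rw [← integral_const_sub_mul_sub]
  exact intervalIntegral.integral_mono_on hcd (Continuous.intervalIntegrable (by fun_prop) _ _)
    (hcont.intervalIntegrable_min_one hac hcd hdb) hle

section Supporting

variable {a b x s : ℝ} {g : ℝ → ℝ}

theorem le_integral_min_one_right (hcont : ContinuousOn g (Icc a b))
    (hnonneg : ∀ z ∈ Icc a b, 0 ≤ g z) (hb : g b = 0) (hx : x ∈ Ico a b) (hs : 0 < s)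
    (hsup : ∀ z ∈ Icc a b, 3 / 4 - s * (z - x) ≤ g z) :
    9 / (32 * s) ≤ ∫ z in x..b, min (g z) 1 := by
  obtain ⟨hax, hxb⟩ := hx
  have hd : 0 < 3 / (4 * s) := by positivity
  have heb : x + 3 / (4 * s) ≤ b := by
    have h := hsup b ⟨hax.trans hxb.le, le_rfl⟩
    rw [hb] at h
    have : 3 / (4 * s) ≤ b - x := by
      rw [div_le_iff₀ (by positivity)]
      linarith
    linarith
  have h1 := le_integral_min_one_of_linear_le (p := 3 / 4) (s := s) (x := x) hcont hax
    (by linarith : x ≤ x + 3 / (4 * s)) heb fun z hz => le_min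
      (hsup z ⟨hax.trans hz.1, hz.2.trans heb⟩)
      (by nlinarith [mul_nonneg hs.le (sub_nonneg.2 hz.1)])
  have h2 : 0 ≤ ∫ z in (x + 3 / (4 * s))..b, min (g z) 1 :=
    intervalIntegral.integral_nonneg heb fun z hz =>
      le_min (hnonneg z ⟨by linarith [hz.1], hz.2⟩) zero_le_one
  rw [← intervalIntegral.integral_add_adjacent_intervals
    (hcont.intervalIntegrable_min_one hax (by linarith) heb)
    (hcont.intervalIntegrable_min_one (by linarith) heb le_rfl)]
  have h3 : 3 / 4 * (x + 3 / (4 * s) - x) - s * ((x + 3 / (4 * s) - x) ^ 2 - (x - x) ^ 2) / 2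
      = 9 / (32 * s) := by
    field_simp
    ring
  linarith

theorem le_integral_min_one_left_of_le (hcont : ContinuousOn g (Icc a b))
    (hx : x ∈ Ico a b) (hs : 0 < s) (hsup : ∀ z ∈ Icc a b, 3 / 4 - s * (z - x) ≤ g z)
    (hd : s * (x - a) ≤ 1 / 4) :
    x - a - 1 / (32 * s) ≤ ∫ z in a..x, min (g z) 1 := by
  obtain ⟨hax, hxb⟩ := hx
  have h1 := le_integral_min_one_of_linear_le (p := 3 / 4) (s := s) (x := x) hcont le_rfl
    hax hxb.le fun z hz => le_min (hsup z ⟨hz.1, hz.2.trans hxb.le⟩)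
      (by nlinarith [mul_nonneg hs.le (sub_nonneg.2 hz.1)])
  have h2 : 3 / 4 * (x - a) - s * ((x - x) ^ 2 - (a - x) ^ 2) / 2 - (x - a - 1 / (32 * s))
      = (4 * s * (x - a) - 1) ^ 2 / (32 * s) := by
    field_simp
    ring
  have h3 : 0 ≤ (4 * s * (x - a) - 1) ^ 2 / (32 * s) := by positivity
  linarith

theorem le_integral_min_one_left (hcont : ContinuousOn g (Icc a b))
    (hx : x ∈ Ico a b) (hs : 0 < s) (hsup : ∀ z ∈ Icc a b, 3 / 4 - s * (z - x) ≤ g z) :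
    x - a - 1 / (32 * s) ≤ ∫ z in a..x, min (g z) 1 := by
  rcases le_total (s * (x - a)) (1 / 4) with hd | hd
  · exact le_integral_min_one_left_of_le hcont hx hs hsup hd
  obtain ⟨hax, hxb⟩ := hx
  set c := x - 1 / (4 * s) with hc
  have hcs : s * (x - c) = 1 / 4 := by
    rw [hc]
    field_simp
    ring
  have hcx : c < x := by
    have : 0 < 1 / (4 * s) := by positivity
    linarith
  have hac : a ≤ c := by
    by_contra! h
    nlinarith
  have h1 := le_integral_min_one_left_of_le (a := c) (hcont.mono (Icc_subset_Icc_left hac))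
    ⟨hcx.le, hxb⟩ hs (fun z hz => hsup z ⟨hac.trans hz.1, hz.2⟩) hcs.le
  have h2 := le_integral_min_one_of_linear_le (p := 1) (s := 0) (x := x) hcont le_rfl
    hac (hcx.le.trans hxb.le) fun z hz => by
      have h := hsup z ⟨hz.1, by linarith [hz.2]⟩
      rw [zero_mul, sub_zero]
      exact le_min (by nlinarith [mul_nonneg hs.le (sub_nonneg.2 hz.2)]) le_rfl
  rw [← intervalIntegral.integral_add_adjacent_intervals
    (hcont.intervalIntegrable_min_one le_rfl hac (hcx.le.trans hxb.le))
    (hcont.intervalIntegrable_min_one hac hcx.le hxb.le)]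
  linarith

theorem le_integral_min_one (hcont : ContinuousOn g (Icc a b))
    (hnonneg : ∀ z ∈ Icc a b, 0 ≤ g z) (hb : g b = 0) (hx : x ∈ Ico a b) (hs : 0 < s)
    (hsup : ∀ z ∈ Icc a b, 3 / 4 - s * (z - x) ≤ g z) :
    x - a + 1 / (4 * s) ≤ ∫ z in a..b, min (g z) 1 := by
  have h1 := le_integral_min_one_left hcont hx hs hsup
  have h2 := le_integral_min_one_right hcont hnonneg hb hx hs hsup
  rw [← intervalIntegral.integral_add_adjacent_intervals
    (hcont.intervalIntegrable_min_one le_rfl hx.1 hx.2.le)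
    (hcont.intervalIntegrable_min_one hx.1 hx.2.le le_rfl)]
  have h3 : x - a - 1 / (32 * s) + 9 / (32 * s) = x - a + 1 / (4 * s) := by
    field_simp
    ring
  linarith

end Supporting

section IntegerEndpoints

variable {a b : ℤ} {g : ℝ → ℝ}

theorem sub_add_half_le_integral_min_one {n : ℤ} (han : a ≤ n) (hnb : n < b)
    (hnonneg : ∀ z ∈ Icc (a : ℝ) b, 0 ≤ g z) (hconv : ConvexOn ℝ (Icc (a : ℝ) b) g)
    (hlip : LipschitzWithConstOn (1 / 2) g (Icc (a : ℝ) b)) (hb : g b = 0)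
    (hn : 3 / 4 ≤ g n) :
    (n - a + 1 / 2 : ℝ) ≤ (∫ z in (a : ℝ)..b, min (g z) 1) ∧
      (g a ≤ 1 → (n - a + 1 / 2 : ℝ) < ∫ z in (a : ℝ)..b, min (g z) 1) := by
  have han' : (a : ℝ) ≤ n := by exact_mod_cast han
  have hnb' : (n : ℝ) < b := by exact_mod_cast hnb
  obtain ⟨s, hs1, hs2, hsup⟩ :=
    hconv.exists_slope_le_of_lipschitzWithConstOn hlip ⟨han', hnb'⟩
  have hs : 0 < s := by
    refine lt_of_lt_of_le (div_pos ?_ (sub_pos.2 hnb')) hs1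
    linarith
  have hsup' : ∀ z ∈ Icc (a : ℝ) b, 3 / 4 - s * (z - n) ≤ g z := fun z hz => by
    linarith [hsup z hz]
  have hcont := hlip.continuousOn
  have h := le_integral_min_one hcont hnonneg hb ⟨han', hnb'⟩ hs hsup'
  have hhalf : 1 / 2 ≤ 1 / (4 * s) := by
    rw [div_le_div_iff₀ (by norm_num) (by positivity)]
    linarith
  refine ⟨by linarith, fun ha => ?_⟩
  rcases han.eq_or_lt with rfl | hlt
  · have h1 := le_integral_min_one_right hcont hnonneg hb ⟨han', hnb'⟩ hs hsup'
    have h2 : 9 / 16 ≤ 9 / (32 * s) := by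
      rw [div_le_div_iff₀ (by norm_num) (by positivity)]
      linarith
    linarith
  · have h1 : (a : ℝ) + 1 ≤ n := by exact_mod_cast hlt
    have h2 := hsup' a ⟨le_rfl, han'.trans hnb'.le⟩
    have h3 : s ≤ 1 / 4 := by nlinarith
    have h4 : 1 ≤ 1 / (4 * s) := by
      rw [le_div_iff₀ (by positivity)]
      linarith
    linarith

theorem trapSum_indicator_le_integral_min_one (hab : a < b)
    (hnonneg : ∀ z ∈ Icc (a : ℝ) b, 0 ≤ g z) (hdec : AntitoneOn g (Icc (a : ℝ) b))
    (hconv : ConvexOn ℝ (Icc (a : ℝ) b) g)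
    (hlip : LipschitzWithConstOn (1 / 2) g (Icc (a : ℝ) b)) (hb : g b = 0) (χ : ℝ → ℝ)
    (hχ : ∀ z, χ z = if 3 / 4 ≤ g z then 1 else 0) :
    χ a / 2 + ∑ m ∈ Finset.Ioo a b, χ m + χ b / 2 ≤ (∫ z in (a : ℝ)..b, min (g z) 1) ∧
      (0 < g a → g a ≤ 1 →
        χ a / 2 + ∑ m ∈ Finset.Ioo a b, χ m + χ b / 2 < ∫ z in (a : ℝ)..b, min (g z) 1) := by
  have hab' : (a : ℝ) < b := by exact_mod_cast hab
  have hχb : χ b = 0 := by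
    rw [hχ, hb, if_neg (by norm_num)]
  have hmem : ∀ m : ℤ, a ≤ m → m ≤ b → (m : ℝ) ∈ Icc (a : ℝ) b := fun m h1 h2 =>
    ⟨by exact_mod_cast h1, by exact_mod_cast h2⟩
  by_cases ha : 3 / 4 ≤ g a
  · obtain ⟨n, ⟨hn1, hn2, hn3⟩, hmax⟩ := Int.exists_greatest_of_bdd
      (P := fun n : ℤ => a ≤ n ∧ n ≤ b ∧ 3 / 4 ≤ g n) ⟨b, fun z hz => hz.2.1⟩
      ⟨a, le_rfl, hab.le, ha⟩
    have hnb : n < b := by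
      refine lt_of_le_of_ne hn2 ?_
      rintro rfl
      rw [hb] at hn3
      norm_num at hn3
    have hsum : ∑ m ∈ Finset.Ioo a b, χ m = n - a := by
      have h1 : ∀ m ∈ Finset.Ioo a b, χ m = if m ∈ Finset.Ioc a n then 1 else 0 := by
        intro m hm
        rw [Finset.mem_Ioo] at hm
        rw [hχ]
        refine if_congr ?_ rfl rfl
        rw [Finset.mem_Ioc]
        refine ⟨fun h => ⟨hm.1, hmax m ⟨hm.1.le, hm.2.le, h⟩⟩, fun h => hn3.trans ?_⟩
        exact hdec (hmem m hm.1.le hm.2.le) (hmem n hn1 hn2) (by exact_mod_cast h.2)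
      rw [Finset.sum_congr rfl h1, Finset.sum_ite_mem,
        Finset.inter_eq_right.2 fun m hm => ?_, Finset.sum_const, Int.card_Ioc, nsmul_eq_mul,
        mul_one]
      · have : (((n - a).toNat : ℤ) : ℝ) = ((n - a : ℤ) : ℝ) := by
          rw [Int.toNat_of_nonneg (by omega)]
        exact_mod_cast this
      · rw [Finset.mem_Ioc] at hm
        rw [Finset.mem_Ioo]
        omega
    rw [hsum, hχb, hχ a, if_pos ha]
    have h := sub_add_half_le_integral_min_one hn1 hnb hnonneg hconv hlip hb hn3
    exact ⟨by linarith [h.1], fun _ h1 => by linarith [h.2 h1]⟩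
  · have hsum : ∑ m ∈ Finset.Ioo a b, χ m = 0 := by
      refine Finset.sum_eq_zero fun m hm => ?_
      rw [Finset.mem_Ioo] at hm
      rw [hχ, if_neg]
      have := hdec (hmem a le_rfl hab.le) (hmem m hm.1.le hm.2.le) (by exact_mod_cast hm.1.le)
      linarith
    rw [hsum, hχb, hχ a, if_neg ha]
    have h0 : ∀ z ∈ Icc (a : ℝ) b, 0 ≤ min (g z) 1 := fun z hz =>
      le_min (hnonneg z hz) zero_le_one
    refine ⟨?_, fun hpos _ => ?_⟩
    · simpa using intervalIntegral.integral_nonneg hab'.le h0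
    · simpa using intervalIntegral.integral_pos hab'
        (hlip.continuousOn.inf continuousOn_const) (fun z hz => h0 z ⟨hz.1.le, hz.2⟩)
        ⟨a, ⟨le_rfl, hab'.le⟩, lt_min hpos one_pos⟩

theorem floor_add_quarter_eq {y : ℝ} (hy : 0 ≤ y) :
    (⌊y + 1 / 4⌋ : ℝ) = ⌊max (y - 1) 0 + 1 / 4⌋ + if 3 / 4 ≤ y then 1 else 0 := by
  rcases le_total 1 y with h | h
  · rw [max_eq_left (by linarith), if_pos (by linarith),
      show y - 1 + 1 / 4 = y + 1 / 4 - 1 by ring, Int.floor_sub_one]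
    push_cast
    ring
  · rw [max_eq_right (by linarith)]
    have h1 : ⌊(0 + 1 / 4 : ℝ)⌋ = 0 := by norm_num
    rw [h1]
    split_ifs with h2
    · have : ⌊y + 1 / 4⌋ = 1 := by
        rw [Int.floor_eq_iff]
        push_cast
        constructor <;> linarith
      rw [this]
      simp
    · have : ⌊y + 1 / 4⌋ = 0 := by
        rw [Int.floor_eq_iff]
        push_cast
        constructor <;> linarith
      rw [this]
      simp

theorem trapSum_add_quarter_le_integral_of_eq_zero (hab : a < b) (K : ℕ)
    (hdec : AntitoneOn g (Icc (a : ℝ) b)) (hconv : ConvexOn ℝ (Icc (a : ℝ) b) g)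
    (hlip : LipschitzWithConstOn (1 / 2) g (Icc (a : ℝ) b)) (hb : g b = 0) (hK : g a ≤ K) :
    trapSum (fun z => g z + 1 / 4) a b ≤ (∫ z in (a : ℝ)..b, g z) ∧
      (0 < g a → trapSum (fun z => g z + 1 / 4) a b < ∫ z in (a : ℝ)..b, g z) := by
  have hab' : (a : ℝ) < b := by exact_mod_cast hab
  induction K generalizing g with
  | zero =>
    have hz : ∀ z ∈ Icc (a : ℝ) b, g z = 0 := fun z hz => by
      refine le_antisymm ?_ ?_
      · simpa using (hdec ⟨le_rfl, hab'.le⟩ hz hz.1).trans hK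
      · exact hb ▸ hdec hz ⟨hab'.le, le_rfl⟩ hz.2
    have h1 : ∫ z in (a : ℝ)..b, g z = 0 := by
      rw [intervalIntegral.integral_congr (g := fun _ => (0 : ℝ))]
      · simp
      · intro z h
        rw [uIcc_of_le hab'.le] at h
        exact hz z h
    have h2 : trapSum (fun z => g z + 1 / 4) a b = 0 := by
      have hf : ∀ m : ℤ, a ≤ m → m ≤ b → ⌊g m + 1 / 4⌋ = 0 := fun m h1 h2 => by
        rw [hz m ⟨by exact_mod_cast h1, by exact_mod_cast h2⟩]
        norm_num
      unfold trapSum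
      rw [Finset.sum_eq_zero, hf a le_rfl hab.le, hf b hab.le le_rfl]
      · simp
      · intro m hm
        rw [Finset.mem_Ioo] at hm
        rw [hf m hm.1.le hm.2.le, Int.cast_zero]
    refine ⟨by rw [h1, h2], fun h => absurd hK (by simpa using h)⟩
  | succ K ih =>
    have hnonneg : ∀ z ∈ Icc (a : ℝ) b, 0 ≤ g z := fun z hz =>
      hb ▸ hdec hz ⟨hab'.le, le_rfl⟩ hz.2
    have hdec' : AntitoneOn (fun z => max (g z - 1) 0) (Icc (a : ℝ) b) :=
      fun z hz w hw hzw => max_le_max (sub_le_sub_right (hdec hz hw hzw) 1) le_rfl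
    have hconv' : ConvexOn ℝ (Icc (a : ℝ) b) (fun z => max (g z - 1) 0) :=
      (hconv.sub (concaveOn_const 1 hconv.1)).sup (convexOn_const 0 hconv.1)
    have hlip' : LipschitzWithConstOn (1 / 2) (fun z => max (g z - 1) 0) (Icc (a : ℝ) b) :=
      fun z hz w hw => by
        refine le_trans ?_ (hlip z hz w hw)
        simpa using abs_max_sub_max_le_abs (g z - 1) (g w - 1) 0
    push_cast at hK
    have IH := ih hdec' hconv' hlip' (by simp [hb])
      (max_le (by linarith) (Nat.cast_nonneg K))
    have hB := trapSum_indicator_le_integral_min_one hab hnonneg hdec hconv hlip hb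
      (fun z => if 3 / 4 ≤ g z then 1 else 0) fun _ => rfl
    have hT : trapSum (fun z => g z + 1 / 4) a b =
        trapSum (fun z => max (g z - 1) 0 + 1 / 4) a b +
          ((if 3 / 4 ≤ g a then 1 else 0) / 2 +
            ∑ m ∈ Finset.Ioo a b, (if 3 / 4 ≤ g m then 1 else 0) +
            (if 3 / 4 ≤ g b then 1 else 0) / 2) := by
      unfold trapSum
      beta_reduce
      have hf : ∀ m ∈ Finset.Ioo a b, (⌊g m + 1 / 4⌋ : ℝ) =
          ⌊max (g m - 1) 0 + 1 / 4⌋ + if 3 / 4 ≤ g m then 1 else 0 := fun m hm => by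
        rw [Finset.mem_Ioo] at hm
        exact floor_add_quarter_eq
          (hnonneg m ⟨by exact_mod_cast hm.1.le, by exact_mod_cast hm.2.le⟩)
      rw [floor_add_quarter_eq (hnonneg a ⟨le_rfl, hab'.le⟩),
        floor_add_quarter_eq (hnonneg b ⟨hab'.le, le_rfl⟩), Finset.sum_congr rfl hf,
        Finset.sum_add_distrib]
      ring
    have hI : ∫ z in (a : ℝ)..b, g z =
        (∫ z in (a : ℝ)..b, max (g z - 1) 0) + ∫ z in (a : ℝ)..b, min (g z) 1 := by
      rw [← intervalIntegral.integral_add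
        (hlip'.continuousOn.intervalIntegrable_of_Icc hab'.le)
        (hlip.continuousOn.intervalIntegrable_min_one le_rfl hab'.le le_rfl)]
      congr 1
      ext z
      rcases le_total (g z) 1 with h | h
      · rw [max_eq_right (by linarith), min_eq_left h, zero_add]
      · rw [max_eq_left (by linarith), min_eq_right h, sub_add_cancel]
    rw [hT, hI]
    refine ⟨add_le_add IH.1 hB.1, fun hpos => ?_⟩
    rcases le_or_gt (g a) 1 with h | h
    · exact add_lt_add_of_le_of_lt IH.1 (hB.2 hpos h)
    · exact add_lt_add_of_lt_of_le (IH.2 (lt_max_of_lt_left (by linarith))) hB.1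

theorem trapSum_sub_intCast (hab : a < b) (k : ℤ) :
    trapSum (fun z => g z - k) a b = trapSum g a b - k * (b - a) := by
  have hcard : (((Finset.Ioo a b).card : ℕ) : ℝ) = b - a - 1 := by
    rw [Int.card_Ioo]
    have : (((b - a - 1).toNat : ℤ) : ℝ) = ((b - a - 1 : ℤ) : ℝ) := by
      rw [Int.toNat_of_nonneg (by omega)]
    exact_mod_cast this
  unfold trapSum
  simp only [Int.floor_sub_intCast, Int.cast_sub, Finset.sum_sub_distrib, Finset.sum_const,
    nsmul_eq_mul, hcard]
  ring

end IntegerEndpoints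

theorem trapSum_convex_quarter (a b : ℤ) (hab : a < b) (g : ℝ → ℝ)
    (hnonneg : ∀ z ∈ Set.Icc (a : ℝ) b, 0 ≤ g z)
    (hdec : AntitoneOn g (Set.Icc (a : ℝ) b))
    (hconv : ConvexOn ℝ (Set.Icc (a : ℝ) b) g)
    (hlip : LipschitzWithConstOn (1 / 2) g (Set.Icc (a : ℝ) b))
    (hint : ∃ k : ℤ, g b = k) :
    trapSum (fun z => g z + 1 / 4) a b ≤ (∫ z in (a : ℝ)..b, g z) ∧
      (trapSum (fun z => g z + 1 / 4) a b = (∫ z in (a : ℝ)..b, g z) →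
        ∀ z ∈ Set.Icc (a : ℝ) b, g z = g a) := by
  obtain ⟨k, hk⟩ := hint
  have hab' : (a : ℝ) < b := by exact_mod_cast hab
  obtain ⟨K, hK⟩ := exists_nat_ge (g a - k)
  have h := trapSum_add_quarter_le_integral_of_eq_zero (g := fun z => g z - k) hab K
    (fun z hz w hw hzw => sub_le_sub_right (hdec hz hw hzw) _)
    (hconv.sub (concaveOn_const _ hconv.1))
    (fun z hz w hw => by simpa using hlip z hz w hw) (by simp [hk]) hK
  have hT : trapSum (fun z => g z - k + 1 / 4) a b =
      trapSum (fun z => g z + 1 / 4) a b - k * (b - a) := by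
    rw [← trapSum_sub_intCast hab]
    congr 1
    ext z
    ring
  have hI : ∫ z in (a : ℝ)..b, (g z - k) = (∫ z in (a : ℝ)..b, g z) - k * (b - a) := by
    rw [intervalIntegral.integral_sub (hlip.continuousOn.intervalIntegrable_of_Icc hab'.le)
      (by simp), intervalIntegral.integral_const, smul_eq_mul, mul_comm]
  rw [hT, hI] at h
  refine ⟨by linarith [h.1], fun heq z hz => ?_⟩
  have ha : g a ≤ g b := by
    by_contra! hlt
    linarith [h.2 (by linarith)]
  exact le_antisymm (hdec ⟨le_rfl, hab'.le⟩ hz hz.1)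
    (ha.trans (hdec hz ⟨hab'.le, le_rfl⟩ hz.2))
end

section
/- Let A, B be integers with A < B, and let g be a function on [A, B+1] which is decreasing and convex, is (1/2)-Lipschitz on [A, B+1], and is (1/3)-Lipschitz on [A+1, B+1]. Suppose that for some integer n one has g(A) ≥ n+1 ≥ g(A+1) ≥ g(B) ≥ n ≥ g(B+1). Then T(g + 1/4, A, B) ≤ ∫_A^B g(t) dt − 1/4. -/
open Real Set

/-- A convex function has a subgradient at every point that is not a right endpoint, and this
subgradient inherits lower bounds on the slopes to the right. -/
lemma ConvexOn.exists_subgradient_ge {s : Set ℝ} {f : ℝ → ℝ} (hf : ConvexOn ℝ s f) {x k : ℝ}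
    (hx : x ∈ s) (hne : ∃ y ∈ s, x < y) (hk : ∀ y ∈ s, x < y → k ≤ (f y - f x) / (y - x)) :
    ∃ p, k ≤ p ∧ ∀ y ∈ s, f x + p * (y - x) ≤ f y := by
  set S : Set ℝ := {r | ∃ y ∈ s, x < y ∧ r = (f y - f x) / (y - x)}
  have hS : S.Nonempty := by
    obtain ⟨y, hy, hxy⟩ := hne
    exact ⟨_, y, hy, hxy, rfl⟩
  have hkS : ∀ r ∈ S, k ≤ r := by
    rintro r ⟨y, hy, hxy, rfl⟩
    exact hk y hy hxy
  refine ⟨sInf S, le_csInf hS hkS, fun y hy => ?_⟩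
  rcases lt_trichotomy y x with hyx | rfl | hxy
  · have h : (f x - f y) / (x - y) ≤ sInf S := by
      refine le_csInf hS ?_
      rintro r ⟨z, hz, hxz, rfl⟩
      exact hf.slope_mono_adjacent hy hz hyx hxz
    rw [div_le_iff₀ (by linarith)] at h
    linarith
  · simp
  · have h : sInf S ≤ (f y - f x) / (y - x) := csInf_le ⟨k, hkS⟩ ⟨y, hy, hxy, rfl⟩
    rw [le_div_iff₀ (by linarith)] at h
    linarith

/-- The integral of an affine function. -/
lemma integral_affine (a b c v p : ℝ) :
    ∫ t in a..b, (v + p * (t - c)) = v * (b - a) + p * ((b - c) ^ 2 - (a - c) ^ 2) / 2 := by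
  rw [intervalIntegral.integral_add (by simp) (by apply Continuous.intervalIntegrable; fun_prop),
    intervalIntegral.integral_const_mul, intervalIntegral.integral_comp_sub_right (fun t => t),
    integral_id, intervalIntegral.integral_const, smul_eq_mul]
  ring

/-- A lower bound for the integral of a function lying above an affine function and then above a
constant. -/
lemma affine_add_const_le_integral {g : ℝ → ℝ} {a u b v p c k : ℝ} (hau : a ≤ u) (hub : u ≤ b)
    (hg : IntervalIntegrable g MeasureTheory.volume a b)
    (h : ∀ t ∈ Icc a u, v + p * (t - c) ≤ g t) (hk : ∀ t ∈ Icc u b, k ≤ g t) :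
    v * (u - a) + p * ((u - c) ^ 2 - (a - c) ^ 2) / 2 + k * (b - u) ≤ ∫ t in a..b, g t := by
  have hg₁ : IntervalIntegrable g MeasureTheory.volume a u :=
    hg.mono_set (by rw [uIcc_of_le hau, uIcc_of_le (hau.trans hub)]; exact Icc_subset_Icc_right hub)
  have hg₂ : IntervalIntegrable g MeasureTheory.volume u b :=
    hg.mono_set (by rw [uIcc_of_le hub, uIcc_of_le (hau.trans hub)]; exact Icc_subset_Icc_left hau)
  rw [← intervalIntegral.integral_add_adjacent_intervals hg₁ hg₂, ← integral_affine]
  refine add_le_add (intervalIntegral.integral_mono_on hau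
    (by apply Continuous.intervalIntegrable; fun_prop) hg₁ h) ?_
  have := intervalIntegral.integral_mono_on hub (by simp) hg₂ hk
  rw [intervalIntegral.integral_const, smul_eq_mul] at this
  linarith

/-- A quadratic inequality for the triangle cut off by a line of slope at least `-1/3`. -/
lemma triangle_area_bound {c : ℤ} (hc : 1 ≤ c) {x : ℝ} (hx : 9 / 4 ≤ x) :
    0 ≤ 3 * x ^ 2 - 2 * (3 + c) * x + 3 * (c : ℝ) ^ 2 := by
  rcases hc.eq_or_lt with rfl | hc
  · push_cast
    nlinarith
  · have hc' : (2 : ℝ) ≤ c := by exact_mod_cast hc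
    nlinarith [sq_nonneg (3 * x - (3 + c))]

/-- A quadratic inequality for the trapezoid cut off at an integer abscissa. -/
lemma trapezoid_area_bound {c j : ℤ} (hc : 1 ≤ c) {σ : ℝ} (hσ : σ ≤ 1 / 3)
    (h₁ : j * σ ≤ 3 / 4) (h₂ : 3 / 4 ≤ (j + 1) * σ) (hj : 0 ≤ j) :
    0 ≤ 3 * (j : ℝ) - 3 - c - 2 * σ * ((j : ℝ) ^ 2 - (c : ℝ) ^ 2) := by
  have hj0 : (0 : ℝ) ≤ j := by exact_mod_cast hj
  have hj2 : 2 ≤ j := by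
    have : (1 : ℝ) < j := by nlinarith
    exact_mod_cast this
  have hc' : (1 : ℝ) ≤ c := by exact_mod_cast hc
  have hj' : (2 : ℝ) ≤ j := by exact_mod_cast hj2
  rcases le_or_gt c j with hcj | hcj
  · have hcj' : (c : ℝ) ≤ j := by exact_mod_cast hcj
    rcases hj2.eq_or_lt with rfl | hj3
    · have : c = 1 ∨ c = 2 := by omega
      rcases this with rfl | rfl <;> push_cast <;> linarith
    · have hj3' : (3 : ℝ) ≤ j := by exact_mod_cast hj3
      have := triangle_area_bound hc (x := j) (by linarith)
      have h : 0 ≤ (j : ℝ) * (3 * (j : ℝ) - 3 - c - 2 * σ * ((j : ℝ) ^ 2 - (c : ℝ) ^ 2)) := by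
        nlinarith [mul_nonneg (sub_nonneg.2 h₁) (show 0 ≤ (j : ℝ) ^ 2 - (c : ℝ) ^ 2 by nlinarith)]
      exact nonneg_of_mul_nonneg_right h (by linarith)
  · have hcj' : (j : ℝ) + 1 ≤ c := by exact_mod_cast hcj
    have h : 0 ≤ ((j : ℝ) + 1) *
        (3 * (j : ℝ) - 3 - c - 2 * σ * ((j : ℝ) ^ 2 - (c : ℝ) ^ 2)) := by
      nlinarith [mul_nonneg (sub_nonneg.2 h₂) (show 0 ≤ (c : ℝ) ^ 2 - (j : ℝ) ^ 2 by nlinarith),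
        sq_nonneg ((c : ℝ) - j - 1)]
    exact nonneg_of_mul_nonneg_right h (by linarith)

/-- A sum whose terms are at most `n + 1` up to `C` and at most `n` afterwards. -/
lemma sum_Ioo_le_of_step {A B C n : ℤ} (hAC : A ≤ C) (hCB : C < B) (F : ℤ → ℤ)
    (h₁ : ∀ m ∈ Finset.Ioo A B, F m ≤ n + 1) (h₂ : ∀ m ∈ Finset.Ioo A B, C < m → F m ≤ n) :
    ∑ m ∈ Finset.Ioo A B, F m ≤ n * (B - A - 1) + (C - A) := by
  calc ∑ m ∈ Finset.Ioo A B, F m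
      ≤ ∑ m ∈ Finset.Ioo A B, (n + if m ≤ C then 1 else 0) := by
        refine Finset.sum_le_sum fun m hm => ?_
        split_ifs with h
        · exact h₁ m hm
        · simpa using h₂ m hm (not_le.1 h)
    _ = n * (B - A - 1) + (C - A) := by
        have hf : (Finset.Ioo A B).filter (· ≤ C) = Finset.Ioc A C := by
          ext m
          simp only [Finset.mem_filter, Finset.mem_Ioo, Finset.mem_Ioc]
          omega
        rw [Finset.sum_add_distrib, Finset.sum_boole, hf, Finset.sum_const, Int.card_Ioo,
          Int.card_Ioc, nsmul_eq_mul, Int.natCast_toNat_eq_self.2 (by omega)]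
        rw [Int.natCast_toNat_eq_self.2 (by omega)]
        ring

theorem trapSum_convex_improved_step (A B : ℤ) (hAB : A < B) (g : ℝ → ℝ)
    (hdec : AntitoneOn g (Set.Icc (A : ℝ) (B + 1)))
    (hconv : ConvexOn ℝ (Set.Icc (A : ℝ) (B + 1)) g)
    (hlip2 : LipschitzWithConstOn (1 / 2) g (Set.Icc (A : ℝ) (B + 1)))
    (hlip3 : LipschitzWithConstOn (1 / 3) g (Set.Icc ((A : ℝ) + 1) (B + 1)))
    (n : ℤ)
    (h1 : (n : ℝ) + 1 ≤ g A) (h2 : g ((A : ℝ) + 1) ≤ (n : ℝ) + 1)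
    (h3 : g B ≤ g ((A : ℝ) + 1)) (h4 : (n : ℝ) ≤ g B) (h5 : g ((B : ℝ) + 1) ≤ (n : ℝ)) :
    trapSum (fun z => g z + 1 / 4) A B ≤ (∫ t in (A : ℝ)..B, g t) - 1 / 4 := by
  have hABr : (A : ℝ) + 1 ≤ B := by exact_mod_cast hAB
  have hmem : ∀ {t : ℝ}, (A : ℝ) ≤ t → t ≤ B + 1 → t ∈ Set.Icc (A : ℝ) (B + 1) :=
    fun h h' => ⟨h, h'⟩
  have hgB : g B ≤ n + 1 / 3 := by
    have := (abs_le.1 (hlip3 B ⟨by linarith, by linarith⟩ (B + 1) ⟨by linarith, le_rfl⟩)).2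
    rw [show (B : ℝ) - (B + 1) = -1 by ring, abs_neg, abs_one] at this
    linarith
  have hgA : g A ≤ n + 3 / 2 := by
    have := (abs_le.1 (hlip2 A (hmem le_rfl (by linarith)) (A + 1)
      (hmem (by linarith) (by linarith)))).2
    rw [show (A : ℝ) - (A + 1) = -1 by ring, abs_neg, abs_one] at this
    linarith
  have hgn : ∀ t : ℝ, A ≤ t → t ≤ B → (n : ℝ) ≤ g t := fun t ht ht' =>
    h4.trans (hdec (hmem ht (by linarith)) (hmem (by linarith) (by linarith)) ht')
  have hint : IntervalIntegrable g MeasureTheory.volume A B := by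
    refine AntitoneOn.intervalIntegrable (hdec.mono ?_)
    rw [uIcc_of_le (by linarith)]
    exact Icc_subset_Icc_right (by linarith)
  obtain ⟨C, ⟨hAC, hCB, hgC⟩, hCmax⟩ := Int.exists_greatest_of_bdd
    (P := fun m : ℤ => A ≤ m ∧ m < B ∧ (n : ℝ) + 3 / 4 ≤ g m)
    ⟨B, fun m hm => hm.2.1.le⟩ ⟨A, le_rfl, hAB, by linarith⟩
  have hCBr : (C : ℝ) + 1 ≤ B := by exact_mod_cast hCB
  have hsum : trapSum (fun z => g z + 1 / 4) A B ≤ n * (B - A) + (C - A) + 1 / 2 := by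
    have hA : (⌊g A + 1 / 4⌋ : ℝ) ≤ n + 1 := by
      have : ⌊g A + 1 / 4⌋ < n + 2 := Int.floor_lt.2 (by push_cast; linarith)
      exact_mod_cast (show ⌊g A + 1 / 4⌋ ≤ n + 1 by omega)
    have hB : (⌊g B + 1 / 4⌋ : ℝ) ≤ n := by
      have : ⌊g B + 1 / 4⌋ < n + 1 := Int.floor_lt.2 (by push_cast; linarith)
      exact_mod_cast (show ⌊g B + 1 / 4⌋ ≤ n by omega)
    have hmid := sum_Ioo_le_of_step (n := n) hAC hCB (fun m => ⌊g m + 1 / 4⌋)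
      (fun m hm => by
        rw [Finset.mem_Ioo] at hm
        have hAm : (A : ℝ) + 1 ≤ m := by exact_mod_cast hm.1
        have hmB : (m : ℝ) ≤ B := by exact_mod_cast hm.2.le
        have := hdec (hmem (t := A + 1) (by linarith) (by linarith))
          (hmem (t := m) (by linarith) (by linarith)) hAm
        have : ⌊g m + 1 / 4⌋ < n + 2 := Int.floor_lt.2 (by push_cast; linarith)
        omega)
      (fun m hm hCm => by
        rw [Finset.mem_Ioo] at hm
        have hlt : g m < n + 3 / 4 := by
          by_contra! h
          exact absurd (hCmax m ⟨hm.1.le, hm.2, h⟩) (not_le.2 hCm)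
        have : ⌊g m + 1 / 4⌋ < n + 1 := Int.floor_lt.2 (by push_cast; linarith)
        omega)
    have hmid' : ∑ m ∈ Finset.Ioo A B, (⌊g m + 1 / 4⌋ : ℝ) ≤ n * (B - A - 1) + (C - A) := by
      exact_mod_cast hmid
    unfold trapSum
    dsimp only
    linarith
  suffices hI : (n : ℝ) * (B - A) + (C - A) + 3 / 4 ≤ ∫ t in (A : ℝ)..B, g t by linarith
  rcases hAC.eq_or_lt with rfl | hAC
  · have := affine_add_const_le_integral (u := A + 1) (v := n + 1) (p := -(1 / 2)) (c := A)
      (k := n) (by linarith) hABr hint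
      (fun t ht => by
        have := (abs_le.1 (hlip2 A (hmem le_rfl (by linarith)) t
          (hmem ht.1 (by linarith [ht.2])))).2
        rw [abs_sub_comm, abs_of_nonneg (by linarith [ht.1])] at this
        linarith)
      (fun t ht => hgn t (by linarith [ht.1]) ht.2)
    linarith
  have hACr : (A : ℝ) + 1 ≤ C := by exact_mod_cast hAC
  obtain ⟨p, hp, hsub⟩ := hconv.exists_subgradient_ge (x := C) (k := -(1 / 3))
    (hmem (by linarith) (by linarith)) ⟨B, hmem (by linarith) (by linarith), by linarith⟩
    (fun y hy hCy => by
      have := (abs_le.1 (hlip3 C ⟨hACr, by linarith⟩ y ⟨by linarith, hy.2⟩)).2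
      rw [abs_sub_comm, abs_of_nonneg (by linarith)] at this
      rw [le_div_iff₀ (by linarith)]
      linarith)
  obtain ⟨σ, rfl⟩ : ∃ σ, p = -σ := ⟨-p, by ring⟩
  have hsub' : ∀ t : ℝ, A ≤ t → t ≤ B + 1 → (n : ℝ) + 3 / 4 + -σ * (t - C) ≤ g t :=
    fun t ht ht' => by linarith [hsub t (hmem ht ht')]
  have hend := hsub' (B + 1) (by linarith) le_rfl
  rcases le_or_gt ((B - C) * σ) (3 / 4) with hσ | hσ
  · have harea := trapezoid_area_bound (c := C - A) (j := B - C) (by omega) (σ := σ)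
      (by linarith) (by push_cast; linarith) (by push_cast; linarith) (by omega)
    have := affine_add_const_le_integral (u := B) (v := n + 3 / 4) (p := -σ) (c := C)
      (k := n) (by linarith) le_rfl hint (fun t ht => hsub' t ht.1 (by linarith [ht.2]))
      (fun t ht => hgn t (by linarith [ht.1]) ht.2)
    push_cast at harea
    linarith
  · have hσ0 : 0 < σ := by
      by_contra! h
      nlinarith
    obtain ⟨x, hx⟩ : ∃ x, x * σ = 3 / 4 := ⟨3 / 4 / σ, by field_simp⟩
    have hx9 : 9 / 4 ≤ x := by nlinarith
    have hxB : x ≤ B - C := by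
      by_contra! h
      nlinarith
    have harea := triangle_area_bound (c := C - A) (by omega) hx9
    have := affine_add_const_le_integral (u := C + x) (v := n + 3 / 4) (p := -σ) (c := C)
      (k := n) (by linarith) (by linarith) hint
      (fun t ht => hsub' t ht.1 (by linarith [ht.2]))
      (fun t ht => hgn t (by linarith [ht.1]) ht.2)
    push_cast at harea
    have hσx : σ = 3 / (4 * x) := by field_simp; linarith
    have hdiff : 0 ≤ 3 / 4 * x - 3 / 4 - (C - A) / 4 - σ * (x ^ 2 - ((C : ℝ) - A) ^ 2) / 2 := by
      have : 3 / 4 * x - 3 / 4 - (C - A) / 4 - σ * (x ^ 2 - ((C : ℝ) - A) ^ 2) / 2 =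
          (3 * x ^ 2 - 2 * (3 + (C - A)) * x + 3 * ((C : ℝ) - A) ^ 2) / (8 * x) := by
        rw [hσx]
        field_simp
        ring
      rw [this]
      positivity
    linarith
end

section
/- Let a, b be integers with a < b, and let g : [a,b] → ℝ be decreasing, convex, (1/2)-Lipschitz on [a,b], with g(b) = 0. Suppose further that there exists t ∈ [a,b] such that g is (1/3)-Lipschitz on [t,b]. Then T(g + 1/4, a, b) ≤ ∫_a^b g(z) dz − (1/4)⌊g(t)⌋. -/
open Real Set

/-- A convex function lying above the line through `(x, g x)` with slope `-L` to the right of `x`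
has at `x` a supporting line of slope `-c` with `0 < c ≤ L`. -/
lemma ConvexOn.exists_supporting_slope {a b x L : ℝ} {g : ℝ → ℝ}
    (hconv : ConvexOn ℝ (Icc a b) g) (hax : a ≤ x) (hxb : x < b) (hg : g b < g x)
    (hL : ∀ y ∈ Ioc x b, g x - L * (y - x) ≤ g y) :
    ∃ c, 0 < c ∧ c ≤ L ∧ ∀ z ∈ Icc a b, g x - c * (z - x) ≤ g z := by
  set S : Set ℝ := (fun y => (g x - g y) / (y - x)) '' Ioc x b with hS
  have hne : S.Nonempty := ⟨_, b, ⟨hxb, le_rfl⟩, rfl⟩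
  have hle : ∀ s ∈ S, s ≤ L := by
    rintro _ ⟨y, hy, rfl⟩
    have := hL y hy
    have h0 : 0 < y - x := sub_pos.2 hy.1
    change (g x - g y) / (y - x) ≤ L
    rw [div_le_iff₀ h0]
    linarith
  have hbdd : BddAbove S := ⟨L, hle⟩
  refine ⟨sSup S, ?_, csSup_le hne hle, ?_⟩
  · refine lt_of_lt_of_le ?_ (le_csSup hbdd ⟨b, ⟨hxb, le_rfl⟩, rfl⟩)
    exact div_pos (sub_pos.2 hg) (sub_pos.2 hxb)
  · intro z hz
    rcases lt_trichotomy z x with hzx | rfl | hxz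
    · have key : sSup S ≤ (g z - g x) / (x - z) := by
        refine csSup_le hne ?_
        rintro _ ⟨y, hy, rfl⟩
        have := hconv.slope_mono_adjacent hz ⟨hax.trans hy.1.le, hy.2⟩ hzx hy.1
        have e1 : (g x - g z) / (x - z) = -((g z - g x) / (x - z)) := by ring
        have e2 : (g y - g x) / (y - x) = -((g x - g y) / (y - x)) := by ring
        change (g x - g y) / (y - x) ≤ _
        linarith
      rw [le_div_iff₀ (sub_pos.2 hzx)] at key
      linarith
    · simp
    · have key : (g x - g z) / (z - x) ≤ sSup S := le_csSup hbdd ⟨z, ⟨hxz, hz.2⟩, rfl⟩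
      rw [div_le_iff₀ (sub_pos.2 hxz)] at key
      linarith

/-- Lower bound for the area of the part of a function between heights `0` and `1`, given a
supporting line of slope `-c` at height `3 / 4`. -/
lemma le_integral_truncation {a b x c : ℝ} {h : ℝ → ℝ} (hcont : ContinuousOn h (Icc a b))
    (hax : a ≤ x) (hxb : x ≤ b) (hc : 0 < c) (hb : h b ≤ 0)
    (hsup : ∀ z ∈ Icc a b, 3 / 4 - c * (z - x) ≤ h z) :
    x - a + 1 / (4 * c) ≤ ∫ z in a..b, max 0 (min 1 (h z)) := by
  obtain ⟨e, he⟩ : ∃ e, e = 1 / c := ⟨_, rfl⟩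
  have hce : c * e = 1 := by rw [he]; field_simp
  have he0 : 0 < e := by rw [he]; positivity
  have he4 : 1 / (4 * c) = e / 4 := by rw [he]; field_simp
  set p := max a (x - e / 4) with hp
  set q := x + 3 / 4 * e with hq
  have hap : a ≤ p := le_max_left _ _
  have hxp : x - e / 4 ≤ p := le_max_right _ _
  have hpx : p ≤ x := max_le hax (by linarith)
  have hpq : p ≤ q := by linarith
  have hqb : q ≤ b := by
    have := hsup b ⟨hax.trans hxb, le_rfl⟩
    nlinarith
  have hF : ContinuousOn (fun z => max 0 (min 1 (h z))) (Icc a b) := by fun_prop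
  have hi : ∀ u v, a ≤ u → u ≤ v → v ≤ b →
      IntervalIntegrable (fun z => max 0 (min 1 (h z))) MeasureTheory.volume u v := by
    intro u v hu huv hv
    exact (hF.mono (Icc_subset_Icc hu hv)).intervalIntegrable_of_Icc huv
  rw [← intervalIntegral.integral_add_adjacent_intervals (hi a p le_rfl hap (by linarith))
      (hi p b hap (by linarith) le_rfl),
    ← intervalIntegral.integral_add_adjacent_intervals (hi p q hap hpq hqb)
      (hi q b (by linarith) hqb le_rfl)]
  have h1 : p - a ≤ ∫ z in a..p, max 0 (min 1 (h z)) := by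
    rcases le_total a (x - e / 4) with hcase | hcase
    · have hpe : p = x - e / 4 := max_eq_right hcase
      have := intervalIntegral.integral_mono_on (f := fun _ => (1 : ℝ)) hap (by simp)
        (hi a p le_rfl hap (by linarith)) (fun z hz => by
          have := hsup z ⟨hz.1, by linarith [hz.2]⟩
          have : 1 ≤ h z := by nlinarith [hz.2]
          simp [this])
      simpa using this
    · have hpe : p = a := max_eq_left hcase
      simp [hpe]
  have h2 : ∫ z in p..q, (3 / 4 - c * (z - x)) ≤ ∫ z in p..q, max 0 (min 1 (h z)) := by
    refine intervalIntegral.integral_mono_on hpq (Continuous.intervalIntegrable (by fun_prop) _ _)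
      (hi p q hap hpq hqb) fun z hz => ?_
    have := hsup z ⟨hap.trans hz.1, hz.2.trans hqb⟩
    refine le_max_of_le_right (le_min ?_ this)
    nlinarith [hz.1]
  have h3 : 0 ≤ ∫ z in q..b, max 0 (min 1 (h z)) :=
    intervalIntegral.integral_nonneg hqb fun _ _ => le_max_left _ _
  have h4 : ∫ z in p..q, (3 / 4 - c * (z - x)) =
      3 / 4 * (q - p) - c * ((q - x) ^ 2 - (p - x) ^ 2) / 2 := by
    have : ∀ z ∈ uIcc p q, HasDerivAt (fun z => 3 / 4 * z - c * (z - x) ^ 2 / 2)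
        (3 / 4 - c * (z - x)) z := by
      intro z _
      have := ((hasDerivAt_id z).const_mul (3 / 4)).sub
        (((((hasDerivAt_id z).sub_const x).pow 2).const_mul c).div_const 2)
      refine HasDerivAt.congr_deriv this ?_
      norm_num
      ring
    rw [intervalIntegral.integral_eq_sub_of_hasDerivAt this
      (Continuous.intervalIntegrable (by fun_prop) _ _)]
    ring
  have h5 : 3 / 4 * (q - p) - c * ((q - x) ^ 2 - (p - x) ^ 2) / 2 - (x - p) - e / 4 =
      c / 2 * (x - p - e / 4) ^ 2 := by
    rw [hq]
    linear_combination (-9 / 32 * e + (x - p) / 4 - e / 32) * hce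
  have h6 : 0 ≤ c / 2 * (x - p - e / 4) ^ 2 := by positivity
  linarith

/-- A nonnegative number, cut off at height `K`, is the sum of its unit layers. -/
lemma sum_range_truncation {u : ℝ} (hu : 0 ≤ u) (K : ℕ) :
    ∑ i ∈ Finset.range K, max 0 (min 1 (u - i)) = min u K := by
  induction K with
  | zero => simp [hu]
  | succ K ih =>
    rw [Finset.sum_range_succ, ih]
    push_cast
    grind

lemma sum_range_indicator_lt {n : ℤ} (hn : 0 ≤ n) (K : ℕ) (hK : n ≤ K) :
    ∑ i ∈ Finset.range K, (if (i : ℤ) < n then (1 : ℝ) else 0) = n := by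
  lift n to ℕ using hn
  have : (Finset.range K).filter (fun i : ℕ => (i : ℤ) < n) = Finset.range n := by
    ext i
    simp
    omega
  rw [Finset.sum_boole, this]
  simp

theorem trapSum_convex_improved (a b : ℤ) (hab : a < b) (g : ℝ → ℝ)
    (hdec : AntitoneOn g (Set.Icc (a : ℝ) b))
    (hconv : ConvexOn ℝ (Set.Icc (a : ℝ) b) g)
    (hlip2 : LipschitzWithConstOn (1 / 2) g (Set.Icc (a : ℝ) b))
    (hb : g b = 0)
    (t : ℝ) (ht : t ∈ Set.Icc (a : ℝ) b)
    (hlip3 : LipschitzWithConstOn (1 / 3) g (Set.Icc t (b : ℝ))) :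
    trapSum (fun z => g z + 1 / 4) a b ≤ (∫ z in (a : ℝ)..b, g z) - (⌊g t⌋ : ℝ) / 4 := by
  have hab' : (a : ℝ) < b := by exact_mod_cast hab
  have hamem : (a : ℝ) ∈ Icc (a : ℝ) b := ⟨le_rfl, hab'.le⟩
  have hbmem : (b : ℝ) ∈ Icc (a : ℝ) b := ⟨hab'.le, le_rfl⟩
  have hpos : ∀ z ∈ Icc (a : ℝ) b, 0 ≤ g z := fun z hz => hb ▸ hdec hz hbmem hz.2
  have hga : ∀ z ∈ Icc (a : ℝ) b, g z ≤ g a := fun z hz => hdec hamem hz hz.1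
  have hcont : ContinuousOn g (Icc (a : ℝ) b) := by
    refine (LipschitzOnWith.of_dist_le_mul (K := 1 / 2) fun z hz w hw => ?_).continuousOn
    simpa [Real.dist_eq] using hlip2 z hz w hw
  have hK0 : 0 ≤ ⌊g a + 1 / 4⌋ := Int.floor_nonneg.2 (by linarith [hpos a hamem])
  obtain ⟨K, hK⟩ := Int.eq_ofNat_of_zero_le hK0
  have hfloor : ∀ z ∈ Icc (a : ℝ) b, ∀ r, 0 ≤ r → r ≤ (1 / 4 : ℝ) →
      ∑ i ∈ Finset.range K, (if (i : ℤ) < ⌊g z + r⌋ then (1 : ℝ) else 0) = ⌊g z + r⌋ := by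
    intro z hz r hr hr'
    refine sum_range_indicator_lt (Int.floor_nonneg.2 (by linarith [hpos z hz])) K ?_
    rw [← hK]
    exact Int.floor_le_floor (by linarith [hga z hz])
  have hfb : ⌊g b + 1 / 4⌋ = 0 := by rw [hb]; norm_num
  have hFcont : ∀ i : ℕ, ContinuousOn (fun z => max 0 (min 1 (g z - i))) (Icc (a : ℝ) b) := by
    intro i
    fun_prop
  have hlevel : ∀ i ∈ Finset.range K,
      1 / 2 + ∑ m ∈ Finset.Ioo a b, (if (i : ℤ) < ⌊g m + 1 / 4⌋ then (1 : ℝ) else 0) +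
        (if (i : ℤ) < ⌊g t + 0⌋ then (1 : ℝ) else 0) / 4 ≤
      ∫ z in (a : ℝ)..b, max 0 (min 1 (g z - i)) := by
    intro i hi
    have hi0 : (0 : ℝ) ≤ i := i.cast_nonneg
    have hlt : ∀ u : ℝ, (i : ℤ) < ⌊u⌋ ↔ (i : ℝ) + 1 ≤ u := by
      intro u
      rw [← Int.add_one_le_iff, Int.le_floor]
      push_cast
      rfl
    have hia : (i : ℝ) + 1 ≤ g a + 1 / 4 := by
      rw [← hlt, hK]
      exact_mod_cast Finset.mem_range.1 hi
    obtain ⟨x, hx, hgx⟩ : (i : ℝ) + 3 / 4 ∈ g '' Icc (a : ℝ) b :=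
      intermediate_value_Icc' hab'.le hcont ⟨by rw [hb]; linarith, by linarith⟩
    have hxb : x < b := by
      refine lt_of_le_of_ne hx.2 fun h => ?_
      rw [h, hb] at hgx
      linarith
    have hgbx : g b < g x := by rw [hb]; linarith
    have hslope : ∀ L : ℝ, (∀ y ∈ Ioc x b, |g x - g y| ≤ L * |x - y|) → 0 < L →
        x - a + 1 / (4 * L) ≤ ∫ z in (a : ℝ)..b, max 0 (min 1 (g z - i)) := by
      intro L hL hL0
      obtain ⟨c, hc, hcL, hsup⟩ := hconv.exists_supporting_slope (L := L) hx.1 hxb hgbx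
        (fun y hy => by
          have := hL y hy
          rw [abs_sub_comm x y, abs_of_pos (sub_pos.2 hy.1)] at this
          linarith [le_abs_self (g x - g y)])
      refine le_trans ?_ (le_integral_truncation (h := fun z => g z - i) (by fun_prop) hx.1 hx.2 hc
        (by simp [hb]) fun z hz => by linarith [hsup z hz])
      gcongr
    have hcount : ∑ m ∈ Finset.Ioo a b, (if (i : ℤ) < ⌊g m + 1 / 4⌋ then (1 : ℝ) else 0) ≤
        x - a := by
      have hsub : (Finset.Ioo a b).filter (fun m : ℤ => (i : ℤ) < ⌊g m + 1 / 4⌋) ⊆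
          Finset.Ioc a ⌊x⌋ := by
        intro m hm
        rw [Finset.mem_filter, Finset.mem_Ioo, hlt] at hm
        obtain ⟨⟨ham, hmb⟩, hgm⟩ := hm
        rw [Finset.mem_Ioc, Int.le_floor]
        refine ⟨ham, ?_⟩
        by_contra! hxm
        have hmb' : (m : ℝ) < b := by exact_mod_cast hmb
        have hs := hconv.slope_mono_adjacent hx hbmem hxm hmb'
        have h1 : 0 ≤ (g m - g x) / (m - x) := div_nonneg (by linarith) (by linarith)
        have h2 : (g b - g m) / (b - m) < 0 := div_neg_of_neg_of_pos (by linarith) (by linarith)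
        linarith
      have hax : a ≤ ⌊x⌋ := Int.le_floor.2 hx.1
      have hcard := Finset.card_le_card hsub
      rw [Int.card_Ioc] at hcard
      rw [Finset.sum_boole]
      have : (((Finset.Ioo a b).filter (fun m : ℤ => (i : ℤ) < ⌊g m + 1 / 4⌋)).card : ℤ) ≤
          ⌊x⌋ - a := by omega
      have : (((Finset.Ioo a b).filter (fun m : ℤ => (i : ℤ) < ⌊g m + 1 / 4⌋)).card : ℝ) ≤
          ⌊x⌋ - a := by exact_mod_cast this
      linarith [Int.floor_le x]
    split_ifs with hit
    · rw [hlt] at hit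
      have htx : t ≤ x := by
        by_contra! hxt
        linarith [hdec hx ht hxt.le]
      have := hslope (1 / 3) (fun y hy => hlip3 x ⟨htx, hx.2⟩ y ⟨htx.trans hy.1.le, hy.2⟩)
        (by norm_num)
      norm_num at this
      linarith
    · have := hslope (1 / 2) (fun y hy => hlip2 x hx y ⟨hx.1.trans hy.1.le, hy.2⟩) (by norm_num)
      norm_num at this
      linarith
  have hsum := Finset.sum_le_sum hlevel
  rw [← intervalIntegral.integral_finsetSum
      (fun i _ => (hFcont i).intervalIntegrable_of_Icc hab'.le),
    Finset.sum_add_distrib, Finset.sum_add_distrib, Finset.sum_comm, ← Finset.sum_div, ← Finset.sum_div,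
    hfloor t ht 0 le_rfl (by norm_num),
    Finset.sum_congr (s₁ := Finset.Ioo a b) rfl (fun m hm => hfloor m (by
      rw [Finset.mem_Ioo] at hm
      exact ⟨by exact_mod_cast hm.1.le, by exact_mod_cast hm.2.le⟩) (1 / 4) (by norm_num) le_rfl)]
    at hsum
  have hint : ∫ z in (a : ℝ)..b, ∑ i ∈ Finset.range K, max 0 (min 1 (g z - i)) ≤
      ∫ z in (a : ℝ)..b, g z := by
    refine intervalIntegral.integral_mono_on hab'.le
      ((continuousOn_finsetSum _ fun i _ => hFcont i).intervalIntegrable_of_Icc hab'.le)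
      (hcont.intervalIntegrable_of_Icc hab'.le) fun z hz => ?_
    rw [sum_range_truncation (hpos z hz)]
    exact min_le_left _ _
  have hKr : (⌊g a + 1 / 4⌋ : ℝ) = K := by rw [hK]; simp
  simp only [Finset.sum_const, Finset.card_range, nsmul_eq_mul, add_zero] at hsum
  simp only [trapSum, hfb, hKr, Int.cast_zero]
  linarith
end

section
/- Let λ > 0 and 0 < w < λ. Then (9/20)·√(1 − w/λ) < (1/π)·arccos(w/λ) < (1/2)·√(1 − w/λ). Equivalently, for all v ∈ (0,1): cos((π/2)√(1−v)) < v < cos((9π/20)√(1−v)). -/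
open Real Set

theorem cos_pi_div_two_mul_lt_one_sub_sq {s : ℝ} (hs0 : 0 < s) (hs1 : s < 1) :
    Real.cos (π / 2 * s) < 1 - s ^ 2 := by
  have hpi := Real.pi_pos
  have hsin : s * Real.sin (π / 4) < Real.sin (π / 4 * s) := by
    have h := strictConcaveOn_sin_Icc.2 (x := 0) (y := π / 4) ⟨le_rfl, hpi.le⟩
      ⟨by positivity, by linarith⟩ (by positivity) (sub_pos.2 hs1) hs0 (by ring)
    simpa [mul_comm s (π / 4)] using h
  have hcos : Real.cos (π / 2 * s) = 1 - 2 * Real.sin (π / 4 * s) ^ 2 := by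
    rw [show π / 2 * s = 2 * (π / 4 * s) by ring, Real.cos_two_mul, Real.cos_sq']
    ring
  have hsq : (s * Real.sin (π / 4)) ^ 2 < Real.sin (π / 4 * s) ^ 2 := by
    have hnonneg : 0 ≤ s * Real.sin (π / 4) := by
      rw [Real.sin_pi_div_four]
      positivity
    gcongr
  rw [mul_pow, Real.sin_pi_div_four, div_pow, Real.sq_sqrt zero_le_two] at hsq
  linarith

theorem one_sub_sq_lt_cos_nine_pi_div_twenty_mul {s : ℝ} (hs : s ≠ 0) :
    1 - s ^ 2 < Real.cos (9 * π / 20 * s) := by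
  have h := Real.one_sub_sq_div_two_lt_cos (x := 9 * π / 20 * s) (by positivity)
  have hpi : (9 * π / 20) ^ 2 ≤ 2 := by
    nlinarith [Real.pi_pos, Real.pi_lt_d4]
  nlinarith [mul_le_mul_of_nonneg_right hpi (sq_nonneg s)]

theorem cos_sqrt_one_sub_bounds {v : ℝ} (hv : v ∈ Set.Ioo (0 : ℝ) 1) :
    Real.cos ((π / 2) * Real.sqrt (1 - v)) < v ∧
      v < Real.cos ((9 * π / 20) * Real.sqrt (1 - v)) := by
  have hs0 : 0 < Real.sqrt (1 - v) := Real.sqrt_pos.2 (sub_pos.2 hv.2)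
  have hs1 : Real.sqrt (1 - v) < 1 := by
    rw [Real.sqrt_lt' one_pos]
    linarith [hv.1]
  have hv' : 1 - Real.sqrt (1 - v) ^ 2 = v := by
    rw [Real.sq_sqrt (sub_nonneg.2 hv.2.le)]
    ring
  have hlt := cos_pi_div_two_mul_lt_one_sub_sq hs0 hs1
  have hgt := one_sub_sq_lt_cos_nine_pi_div_twenty_mul hs0.ne'
  rw [hv'] at hlt hgt
  exact ⟨hlt, hgt⟩

theorem arccos_bounds (lam w : ℝ) (hlam : 0 < lam) (hw0 : 0 < w) (hw : w < lam) :
    ((9 / 20) * Real.sqrt (1 - w / lam) < (1 / π) * Real.arccos (w / lam) ∧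
      (1 / π) * Real.arccos (w / lam) < (1 / 2) * Real.sqrt (1 - w / lam)) ∧
    (∀ v ∈ Set.Ioo (0 : ℝ) 1,
      Real.cos ((π / 2) * Real.sqrt (1 - v)) < v ∧
      v < Real.cos ((9 * π / 20) * Real.sqrt (1 - v))) := by
  refine ⟨?_, fun v hv => cos_sqrt_one_sub_bounds hv⟩
  have hv : w / lam ∈ Set.Ioo (0 : ℝ) 1 := ⟨div_pos hw0 hlam, (div_lt_one hlam).2 hw⟩
  obtain ⟨hlt, hgt⟩ := cos_sqrt_one_sub_bounds hv
  generalize w / lam = v at *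
  have hpi := Real.pi_pos
  have hs1 : Real.sqrt (1 - v) ≤ 1 := Real.sqrt_le_one.2 (by linarith [hv.1])
  have hcos : Real.cos (Real.arccos v) = v :=
    Real.cos_arccos (by linarith [hv.1]) hv.2.le
  have hlower : 9 * π / 20 * Real.sqrt (1 - v) < Real.arccos v := by
    by_contra! h
    have := Real.cos_le_cos_of_nonneg_of_le_pi (Real.arccos_nonneg v) (by nlinarith) h
    linarith
  have hupper : Real.arccos v < π / 2 * Real.sqrt (1 - v) := by
    by_contra! h
    have := Real.cos_le_cos_of_nonneg_of_le_pi (by positivity) (Real.arccos_le_pi v) h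
    linarith
  rw [one_div_mul_eq_div, lt_div_iff₀ hpi, div_lt_iff₀ hpi]
  constructor <;> linarith
end

section
/- Let 0 < z < λ. Then (3λ/10)·(1 − z/λ)^{3/2} < G_λ(z) < (λ/3)·(1 − z/λ)^{3/2}. -/
open Real Set

/-- The function `G_λ(z) = (1/π)(√(λ² − z²) − z·arccos(z/λ))` for `z ≤ λ`, and `0` for `z > λ`. -/
noncomputable def funG (lam z : ℝ) : ℝ :=
  if z ≤ lam then (Real.sqrt (lam ^ 2 - z ^ 2) - z * Real.arccos (z / lam)) / π else 0

theorem sin_gt_chord_pi_div_four {u : ℝ} (hu : 0 < u) (hu' : u < π / 4) :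
    2 * √2 / π * u < sin u := by
  have hpi := pi_pos
  have hw : 0 < 1 - u / (π / 4) := sub_pos.2 ((div_lt_one (by positivity)).2 hu')
  have h := strictConcaveOn_sin_Icc.2 ⟨le_rfl, hpi.le⟩
    (⟨by positivity, by linarith⟩ : π / 4 ∈ Icc 0 π) (by positivity) hw
    (show 0 < u / (π / 4) by positivity) (by ring)
  simp only [smul_eq_mul, sin_zero, mul_zero, zero_add, sin_pi_div_four] at h
  rw [div_mul_cancel₀ u (by positivity)] at h
  have hslope : u / (π / 4) * (√2 / 2) = 2 * √2 / π * u := by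
    field_simp
    norm_num
  rwa [hslope] at h

theorem hasDerivAt_sin_two_mul_sub (c u : ℝ) :
    HasDerivAt (fun t ↦ sin (2 * t) - 2 * t * cos (2 * t) - c * sin t ^ 3)
      (sin u * cos u * (8 * u - 3 * c * sin u)) u := by
  have h2 : HasDerivAt (fun t : ℝ ↦ 2 * t) 2 u := by
    simpa using (hasDerivAt_id u).const_mul 2
  refine ((h2.sin.sub (h2.mul h2.cos)).sub
    (((hasDerivAt_sin u).pow 3).const_mul c)).congr_deriv ?_
  rw [sin_two_mul]
  push_cast
  ring

theorem eight_thirds_mul_sin_pow_three_lt {u : ℝ} (hu : 0 < u) (hu' : u < π / 2) :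
    8 / 3 * sin u ^ 3 < sin (2 * u) - 2 * u * cos (2 * u) := by
  have hmono : StrictMonoOn
      (fun t ↦ sin (2 * t) - 2 * t * cos (2 * t) - 8 / 3 * sin t ^ 3) (Icc 0 (π / 2)) := by
    refine strictMonoOn_of_deriv_pos (convex_Icc _ _) (by fun_prop) fun t ht ↦ ?_
    rw [interior_Icc] at ht
    rw [(hasDerivAt_sin_two_mul_sub _ t).deriv]
    have hs := sin_pos_of_pos_of_lt_pi ht.1 (by linarith [ht.2, pi_pos])
    have hc := cos_pos_of_mem_Ioo ⟨by linarith [ht.1, pi_pos], ht.2⟩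
    have := sin_lt ht.1
    exact mul_pos (mul_pos hs hc) (by linarith)
  have := hmono ⟨le_rfl, by positivity⟩ ⟨hu.le, hu'.le⟩ hu
  simp at this
  linarith

theorem sin_two_mul_sub_lt {u : ℝ} (hu : 0 < u) (hu' : u < π / 4) :
    sin (2 * u) - 2 * u * cos (2 * u) < 2 * √2 * π / 3 * sin u ^ 3 := by
  have hanti : StrictAntiOn
      (fun t ↦ sin (2 * t) - 2 * t * cos (2 * t) - 2 * √2 * π / 3 * sin t ^ 3)
      (Icc 0 (π / 4)) := by
    refine strictAntiOn_of_deriv_neg (convex_Icc _ _) (by fun_prop) fun t ht ↦ ?_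
    rw [interior_Icc] at ht
    rw [(hasDerivAt_sin_two_mul_sub _ t).deriv]
    have hs := sin_pos_of_pos_of_lt_pi ht.1 (by linarith [ht.2, pi_pos])
    have hc : 0 < cos t :=
      cos_pos_of_mem_Ioo ⟨by linarith [ht.1, pi_pos], by linarith [ht.2, pi_pos]⟩
    have h := mul_lt_mul_of_pos_left (sin_gt_chord_pi_div_four ht.1 ht.2)
      (show 0 < 2 * √2 * π by positivity)
    have h8 : 2 * √2 * π * (2 * √2 / π * t) = 8 * t := by
      field_simp
      norm_num [mul_comm]
    exact mul_neg_of_pos_of_neg (mul_pos hs hc) (by linarith)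
  have := hanti ⟨le_rfl, by positivity⟩ ⟨hu.le, hu'.le⟩ hu
  simp at this
  linarith

theorem one_sub_cos_rpow_three_halves {θ : ℝ} (h : 0 ≤ sin (θ / 2)) :
    (1 - cos θ) ^ ((3 : ℝ) / 2) = 2 * √2 * sin (θ / 2) ^ 3 := by
  have h2 : √2 ^ 2 = (2 : ℝ) := sq_sqrt zero_le_two
  have hsq : 1 - cos θ = (√2 * sin (θ / 2)) ^ (2 : ℝ) := by
    rw [rpow_two, mul_pow, h2, sin_sq_eq_half_sub, mul_div_cancel₀ θ two_ne_zero]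
    ring
  rw [hsq, ← rpow_mul (by positivity), show (2 : ℝ) * (3 / 2) = (3 : ℕ) by norm_num,
    rpow_natCast, mul_pow, pow_succ √2 2, h2]

theorem funG_mul_cos {lam θ : ℝ} (hlam : 0 < lam) (h0 : 0 ≤ θ) (hpi : θ ≤ π) :
    funG lam (lam * cos θ) = lam * (sin θ - θ * cos θ) / π := by
  have hsqrt : √(lam ^ 2 - (lam * cos θ) ^ 2) = lam * sin θ := by
    rw [show lam ^ 2 - (lam * cos θ) ^ 2 = (lam * sin θ) ^ 2 by
      rw [mul_pow, mul_pow, sin_sq]; ring]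
    exact sqrt_sq (mul_nonneg hlam.le (sin_nonneg_of_nonneg_of_le_pi h0 hpi))
  rw [funG, if_pos (mul_le_of_le_one_right hlam.le (cos_le_one θ)), hsqrt,
    mul_div_cancel_left₀ _ hlam.ne', arccos_cos h0 hpi]
  ring

theorem funG_bounds (lam z : ℝ) (hz : 0 < z) (hzl : z < lam) :
    (3 * lam / 10) * (1 - z / lam) ^ ((3 : ℝ) / 2) < funG lam z ∧
    funG lam z < (lam / 3) * (1 - z / lam) ^ ((3 : ℝ) / 2) := by
  have hlam : 0 < lam := hz.trans hzl
  obtain ⟨u, hu0, hu4, rfl⟩ : ∃ u, 0 < u ∧ u < π / 4 ∧ z = lam * cos (2 * u) := by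
    have hpos : 0 < z / lam := div_pos hz hlam
    have hlt : z / lam < 1 := (div_lt_one hlam).2 hzl
    refine ⟨arccos (z / lam) / 2, half_pos (arccos_pos.2 hlt), ?_, ?_⟩
    · linarith [arccos_lt_pi_div_two.2 hpos]
    · rw [mul_div_cancel₀ _ two_ne_zero, cos_arccos (by linarith) hlt.le,
        mul_div_cancel₀ _ hlam.ne']
  have hs : 0 < sin u := sin_pos_of_pos_of_lt_pi hu0 (by linarith [pi_pos])
  have hhalf : 2 * u / 2 = u := by ring
  rw [funG_mul_cos hlam (by linarith) (by linarith [pi_pos]), mul_div_cancel_left₀ _ hlam.ne',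
    one_sub_cos_rpow_three_halves (by rw [hhalf]; exact hs.le), hhalf,
    lt_div_iff₀ pi_pos, div_lt_iff₀ pi_pos]
  constructor
  · have hsqrt : √2 < 1.41422 := (sqrt_lt' (by norm_num)).2 (by norm_num)
    have hconst : 3 / 10 * (2 * √2) * π ≤ 8 / 3 := by
      nlinarith [pi_lt_d4, pi_pos]
    calc 3 * lam / 10 * (2 * √2 * sin u ^ 3) * π
        = lam * (3 / 10 * (2 * √2) * π * sin u ^ 3) := by ring
      _ ≤ lam * (8 / 3 * sin u ^ 3) := by gcongr
      _ < _ := mul_lt_mul_of_pos_left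
          (eight_thirds_mul_sin_pow_three_lt hu0 (by linarith [pi_pos])) hlam
  · calc _ < lam * (2 * √2 * π / 3 * sin u ^ 3) :=
          mul_lt_mul_of_pos_left (sin_two_mul_sub_lt hu0 hu4) hlam
      _ = _ := by ring
end

section
/- Let μ ≥ 1. Then ∫_{⌊μ⌋}^{μ} G_μ(z) dz < 2/(15√μ). -/
open Real Set

theorem arccos_le_pi_div_two_mul_sqrt {x : ℝ} (hx : 0 ≤ x) (hx1 : x ≤ 1) :
    arccos x ≤ π / 2 * √(1 - x) := by
  have hpi := pi_pos
  set θ := arccos x with hθ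
  have h0 : 0 ≤ θ := arccos_nonneg x
  have h1 : θ ≤ π / 2 := arccos_le_pi_div_two.2 hx
  have hc : cos θ = x := cos_arccos (by linarith) hx1
  have hsin : 2 * θ / π * sin (π / 4) ≤ sin (θ / 2) := by
    have ha : 2 * θ / π ≤ 1 := by rw [div_le_one hpi]; linarith
    have h := strictConcaveOn_sin_Icc.concaveOn.2
      (show (0 : ℝ) ∈ Icc 0 π from ⟨le_rfl, hpi.le⟩)
      (show π / 4 ∈ Icc 0 π from ⟨by linarith, by linarith⟩)
      (show 0 ≤ 1 - 2 * θ / π by linarith) (show 0 ≤ 2 * θ / π by positivity) (by ring)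
    simp only [smul_eq_mul, sin_zero, mul_zero, zero_add] at h
    rwa [show 2 * θ / π * (π / 4) = θ / 2 by field_simp; ring] at h
  have hx2 : 1 - x = 2 * sin (θ / 2) ^ 2 := by
    have h := cos_sq' (θ / 2)
    have h' := cos_two_mul (θ / 2)
    rw [show 2 * (θ / 2) = θ by ring, hc] at h'
    linarith
  have hsq : (2 * θ / π) ^ 2 ≤ 1 - x := by
    rw [sin_pi_div_four] at hsin
    have h := pow_le_pow_left₀ (by positivity) hsin 2
    rw [mul_pow, div_pow (√2), sq_sqrt (by norm_num)] at h
    linarith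
  have h := le_sqrt_of_sq_le hsq
  calc θ = π / 2 * (2 * θ / π) := by field_simp
    _ ≤ _ := by gcongr

theorem hasDerivAt_sqrt_sub_mul_arccos {lam z : ℝ} (hz : 0 < z) (hzl : z < lam) :
    HasDerivAt (fun z => √(lam ^ 2 - z ^ 2) - z * arccos (z / lam)) (-arccos (z / lam)) z := by
  have hl : 0 < lam := hz.trans hzl
  have hpos : 0 < lam ^ 2 - z ^ 2 := by nlinarith
  have hd : z / lam < 1 := (div_lt_one hl).2 hzl
  have hd0 : 0 < z / lam := div_pos hz hl
  have h1 := (((hasDerivAt_id z).pow 2).const_sub (lam ^ 2)).sqrt hpos.ne'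
  have h2 := (hasDerivAt_arccos (by linarith) hd.ne).comp z ((hasDerivAt_id z).div_const lam)
  have h3 := h1.sub ((hasDerivAt_id z).mul h2)
  have hs : √(1 - (z / lam) ^ 2) = √(lam ^ 2 - z ^ 2) / lam := by
    rw [show 1 - (z / lam) ^ 2 = (lam ^ 2 - z ^ 2) / lam ^ 2 by field_simp,
      sqrt_div hpos.le, sqrt_sq hl.le]
  have hne := (sqrt_pos.2 hpos).ne'
  refine h3.congr_deriv ?_
  simp only [id, Function.comp, Pi.pow_apply, hs]
  field_simp
  ring

theorem funG_le_rpow {lam z : ℝ} (hz : 0 < z) (hzl : z ≤ lam) :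
    funG lam z ≤ (lam - z) ^ (3 / 2 : ℝ) / (3 * √lam) := by
  have hl : 0 < lam := hz.trans_le hzl
  have hsl : 0 < √lam := sqrt_pos.2 hl
  let h : ℝ → ℝ := fun z => π * ((lam - z) ^ (3 / 2 : ℝ) / (3 * √lam)) -
    (√(lam ^ 2 - z ^ 2) - z * arccos (z / lam))
  have hcont : Continuous h := by
    have : Continuous fun z : ℝ => (lam - z) ^ (3 / 2 : ℝ) :=
      (continuous_const.sub continuous_id).rpow_const fun _ => Or.inr (by norm_num)
    have h2 : Continuous fun z : ℝ => arccos (z / lam) :=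
      continuous_arccos.comp (continuous_id.div_const lam)
    fun_prop
  have hanti : AntitoneOn h (Icc z lam) := by
    refine antitoneOn_of_hasDerivWithinAt_nonpos (convex_Icc z lam) hcont.continuousOn
      (f' := fun y => π * (-(3 / 2 * (lam - y) ^ (1 / 2 : ℝ)) / (3 * √lam)) +
        arccos (y / lam)) ?_ ?_
    · intro y hy
      rw [interior_Icc] at hy
      have hd := ((((hasDerivAt_id y).const_sub lam).rpow_const (p := 3 / 2)
        (Or.inr (by norm_num))).div_const (3 * √lam)).const_mul π
      refine HasDerivAt.hasDerivWithinAt ((hd.sub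
        (hasDerivAt_sqrt_sub_mul_arccos (hz.trans hy.1) hy.2)).congr_deriv ?_)
      norm_num
    · intro y hy
      rw [interior_Icc] at hy
      have hb := arccos_le_pi_div_two_mul_sqrt (x := y / lam)
        (div_pos (hz.trans hy.1) hl).le ((div_le_one hl).2 hy.2.le)
      rw [show 1 - y / lam = (lam - y) / lam by field_simp,
        sqrt_div (by linarith [hy.2])] at hb
      rw [← sqrt_eq_rpow]
      have : π * (-(3 / 2 * √(lam - y)) / (3 * √lam)) = -(π / 2 * (√(lam - y) / √lam)) := by
        field_simp
      linarith
  have hle := hanti (left_mem_Icc.2 hzl) (right_mem_Icc.2 hzl) hzl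
  have hlam : h lam = 0 := by simp [h, hl.ne']
  rw [hlam] at hle
  rw [funG, if_pos hzl, div_le_iff₀ pi_pos]
  simp only [h] at hle
  linarith

theorem continuousOn_funG (lam a : ℝ) : ContinuousOn (funG lam) (Icc a lam) := by
  have h2 : Continuous fun z : ℝ => arccos (z / lam) :=
    continuous_arccos.comp (continuous_id.div_const lam)
  have h : Continuous fun z : ℝ => (√(lam ^ 2 - z ^ 2) - z * arccos (z / lam)) / π := by fun_prop
  exact h.continuousOn.congr fun z hz => if_pos hz.2

theorem funG_tail_integral (mu : ℝ) (hmu : 1 ≤ mu) :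
    (∫ z in ((⌊mu⌋ : ℝ))..mu, funG mu z) < 2 / (15 * Real.sqrt mu) := by
  have hle : (⌊mu⌋ : ℝ) ≤ mu := Int.floor_le mu
  have hlt : mu - ⌊mu⌋ < 1 := by linarith [Int.lt_floor_add_one mu]
  have hpos : (0 : ℝ) < ⌊mu⌋ := by exact_mod_cast Int.floor_pos.2 hmu
  have hs : 0 < √mu := sqrt_pos.2 (by linarith)
  have hcont : Continuous fun z : ℝ => (mu - z) ^ (3 / 2 : ℝ) / (3 * √mu) :=
    ((continuous_const.sub continuous_id).rpow_const fun _ => Or.inr (by norm_num)).div_const _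
  calc (∫ z in (⌊mu⌋ : ℝ)..mu, funG mu z)
      ≤ ∫ z in (⌊mu⌋ : ℝ)..mu, (mu - z) ^ (3 / 2 : ℝ) / (3 * √mu) := by
        refine intervalIntegral.integral_mono_on hle
          ((continuousOn_funG mu _).intervalIntegrable_of_Icc hle)
          (hcont.intervalIntegrable _ _) fun z hz => funG_le_rpow (hpos.trans_le hz.1) hz.2
    _ = (mu - ⌊mu⌋) ^ (5 / 2 : ℝ) * (2 / (15 * √mu)) := by
        rw [intervalIntegral.integral_div,
          intervalIntegral.integral_comp_sub_left (fun x => x ^ (3 / 2 : ℝ)),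
          integral_rpow (Or.inl (by norm_num)), sub_self, zero_rpow (by norm_num)]
        norm_num
        field_simp
        ring
    _ < 1 * (2 / (15 * √mu)) := by
        gcongr
        exact rpow_lt_one (by linarith) hlt (by norm_num)
    _ = _ := one_mul _
end

section
/- Set r₀ = 0, r₁ = 2/3, r₂ = 4/5, r₃ = 17/20, r₄ = 22/25, r₅ = 1, and define η_II(r) = (j+1)π√r/(1−r) whenever r_j ≤ r < r_{j+1}, j = 0,1,2,3,4. Then for every r ∈ (0,1) and every λ with 0 < λ < η_II(r), the number of pairs (n,m), with n a positive integer and m an integer, satisfying m² + π²rn²/(1−r)² ≤ λ², is strictly less than (1−r²)λ²/4. -/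
open Real Set

/-- `η_II(r) = (j+1)π√r/(1−r)` for `r ∈ [r_j, r_{j+1})`, where
`r₀ = 0, r₁ = 2/3, r₂ = 4/5, r₃ = 17/20, r₄ = 22/25, r₅ = 1`. -/
noncomputable def etaII (r : ℝ) : ℝ :=
  if r < 2 / 3 then π * Real.sqrt r / (1 - r)
  else if r < 4 / 5 then 2 * π * Real.sqrt r / (1 - r)
  else if r < 17 / 20 then 3 * π * Real.sqrt r / (1 - r)
  else if r < 22 / 25 then 4 * π * Real.sqrt r / (1 - r)
  else 5 * π * Real.sqrt r / (1 - r)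

/-- Slicing the half-ellipse into the lines `n = 1, …, M` bounds its number of lattice points. -/
theorem ncard_halfEllipse_le (a lam : ℝ) (ha : 0 < a) (hlam : 0 < lam) (M : ℕ)
    (hM : lam < a * (M + 1)) :
    (Set.ncard {p : ℤ × ℤ | 1 ≤ p.1 ∧
        (p.2 : ℝ) ^ 2 + a ^ 2 * (p.1 : ℝ) ^ 2 ≤ lam ^ 2} : ℝ) ≤
      ∑ i : Fin M, (2 * √(lam ^ 2 - a ^ 2 * ((i : ℝ) + 1) ^ 2) + 1) := by
  set k : Fin M → ℕ := fun i => ⌊√(lam ^ 2 - a ^ 2 * ((i : ℝ) + 1) ^ 2)⌋₊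
  set T : Finset (ℤ × ℤ) := Finset.univ.biUnion
    (fun i : Fin M => (Finset.Icc (-(k i : ℤ)) (k i)).image (fun m => ((i : ℤ) + 1, m)))
  have hsub : {p : ℤ × ℤ | 1 ≤ p.1 ∧
      (p.2 : ℝ) ^ 2 + a ^ 2 * (p.1 : ℝ) ^ 2 ≤ lam ^ 2} ⊆ (T : Set (ℤ × ℤ)) := by
    rintro ⟨n, m⟩ ⟨hn, h⟩
    dsimp only at hn h
    have hn' : (1 : ℝ) ≤ n := by exact_mod_cast hn
    have hle : a * n ≤ lam := abs_le_of_sq_le_sq' (by nlinarith [sq_nonneg (m : ℝ)]) hlam.le |>.2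
    have hnM : n < M + 1 := by
      have : (n : ℝ) < M + 1 := lt_of_mul_lt_mul_left (hle.trans_lt hM) ha.le
      exact_mod_cast this
    have hi : (n - 1).toNat < M := by omega
    have hin : (((n - 1).toNat : ℕ) : ℤ) = n - 1 := Int.toNat_of_nonneg (by omega)
    have hinr : (((n - 1).toNat : ℕ) : ℝ) + 1 = n := by
      have : ((((n - 1).toNat : ℕ) : ℤ) : ℝ) = ((n - 1 : ℤ) : ℝ) := by rw [hin]
      push_cast at this
      linarith
    have hm : m.natAbs ≤ k ⟨(n - 1).toNat, hi⟩ := by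
      apply Nat.le_floor
      dsimp only
      rw [hinr, Nat.cast_natAbs, Int.cast_abs]
      exact Real.abs_le_sqrt (by linarith)
    simp only [T, Finset.coe_biUnion, Set.mem_iUnion, Finset.coe_image, Set.mem_image]
    refine ⟨⟨(n - 1).toNat, hi⟩, by simp, m, ?_, ?_⟩
    · simp only [Finset.coe_Icc, Set.mem_Icc]
      omega
    · exact Prod.ext (by simp only [hin]; ring) rfl
  have hcard : T.card ≤ ∑ i : Fin M, (2 * k i + 1) := by
    refine Finset.card_biUnion_le.trans (Finset.sum_le_sum fun i _ => ?_)
    refine Finset.card_image_le.trans ?_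
    rw [Int.card_Icc]
    omega
  have hncard := Set.ncard_le_ncard hsub T.finite_toSet
  rw [Set.ncard_coe_finset] at hncard
  calc _ ≤ ((∑ i : Fin M, (2 * k i + 1) : ℕ) : ℝ) := by exact_mod_cast hncard.trans hcard
    _ ≤ _ := by
      push_cast
      gcongr with i
      exact Nat.floor_le (Real.sqrt_nonneg _)

/-- Replacing each square root by the tangent line `2 s ≤ s² / (α a) + α a` bounds the number of
lattice points by a multiple of `lam ^ 2`. -/
theorem ncard_halfEllipse_lt (a c lam : ℝ) (ha : 0 < a) (hlam : 0 < lam) (M : ℕ)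
    (hM : lam < a * (M + 1)) (hM' : a * M ≤ lam) (α : Fin M → ℝ) (hα : ∀ i, 0 < α i)
    (hc : ∑ i, 1 / α i ≤ c * a)
    (hneg : a * ∑ i, (α i - ((i : ℝ) + 1) ^ 2 / α i) + M < 0) :
    (Set.ncard {p : ℤ × ℤ | 1 ≤ p.1 ∧
        (p.2 : ℝ) ^ 2 + a ^ 2 * (p.1 : ℝ) ^ 2 ≤ lam ^ 2} : ℝ) < c * lam ^ 2 := by
  refine (ncard_halfEllipse_le a lam ha hlam M hM).trans_lt ?_
  have hterm : ∀ i : Fin M, 2 * √(lam ^ 2 - a ^ 2 * ((i : ℝ) + 1) ^ 2) + 1 ≤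
      lam ^ 2 / a * (1 / α i) + a * (α i - ((i : ℝ) + 1) ^ 2 / α i) + 1 := by
    intro i
    have hi : (i : ℝ) + 1 ≤ M := by exact_mod_cast i.2
    have hnonneg : 0 ≤ lam ^ 2 - a ^ 2 * ((i : ℝ) + 1) ^ 2 := by
      have h1 : a * ((i : ℝ) + 1) ≤ lam := (mul_le_mul_of_nonneg_left hi ha.le).trans hM'
      have h2 : 0 ≤ a * ((i : ℝ) + 1) := by positivity
      nlinarith
    set s := √(lam ^ 2 - a ^ 2 * ((i : ℝ) + 1) ^ 2)
    have hsq : s ^ 2 = lam ^ 2 - a ^ 2 * ((i : ℝ) + 1) ^ 2 := Real.sq_sqrt hnonneg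
    have hαi := hα i
    have heq : lam ^ 2 / a * (1 / α i) + a * (α i - ((i : ℝ) + 1) ^ 2 / α i) - 2 * s =
        (s - α i * a) ^ 2 / (α i * a) := by
      rw [show lam ^ 2 = s ^ 2 + a ^ 2 * ((i : ℝ) + 1) ^ 2 by linarith]
      field_simp
      ring
    have : 0 ≤ (s - α i * a) ^ 2 / (α i * a) := by positivity
    linarith
  refine (Finset.sum_le_sum fun i _ => hterm i).trans_lt ?_
  rw [Finset.sum_add_distrib, Finset.sum_add_distrib, ← Finset.mul_sum, ← Finset.mul_sum]
  have h1 : lam ^ 2 / a * ∑ i, 1 / α i ≤ c * lam ^ 2 := by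
    calc _ ≤ lam ^ 2 / a * (c * a) := by gcongr
      _ = _ := by field_simp
  simp only [Finset.sum_const, Finset.card_univ, Fintype.card_fin, nsmul_eq_mul, mul_one]
  linarith

theorem cylinder_polya (r lam : ℝ) (hr0 : 0 < r) (hr1 : r < 1)
    (hlam0 : 0 < lam) (hlam : lam < etaII r) :
    (Set.ncard {p : ℤ × ℤ | 1 ≤ p.1 ∧
        (p.2 : ℝ) ^ 2 + π ^ 2 * r * (p.1 : ℝ) ^ 2 / (1 - r) ^ 2 ≤ lam ^ 2} : ℝ) <
      (1 - r ^ 2) * lam ^ 2 / 4 := by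
  have h1r : 0 < 1 - r := by linarith
  obtain ⟨a, ha_def⟩ : ∃ a, a = π * √r / (1 - r) := ⟨_, rfl⟩
  have hsr : 0 < √r := Real.sqrt_pos.2 hr0
  have ha : 0 < a := by rw [ha_def]; positivity
  have ha2 (x : ℝ) : π ^ 2 * r * x ^ 2 / (1 - r) ^ 2 = a ^ 2 * x ^ 2 := by
    rw [ha_def, div_pow, mul_pow, Real.sq_sqrt hr0.le]
    ring
  have hca : (1 - r ^ 2) / 4 * a = π * √r * (1 + r) / 4 := by
    rw [ha_def]
    field_simp
    ring
  have hpi : 3.1415 < π := Real.pi_gt_d4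
  simp only [ha2]
  rw [mul_div_right_comm]
  have hlower : ∀ q ρ : ℝ, 0 < q → q ^ 2 ≤ ρ → ρ < 1 → ρ ≤ r →
      3.1415 * q * (1 + ρ) / 4 ≤ (1 - r ^ 2) / 4 * a ∧ 3.1415 * q / (1 - ρ) ≤ a := by
    intro q ρ hq hqρ hρ1 hρ
    have hqr : q ≤ √r := Real.le_sqrt_of_sq_le (hqρ.trans hρ)
    have hρ0 : 0 < ρ := (by positivity : 0 < q ^ 2).trans_le hqρ
    rw [hca, ha_def]
    constructor <;> gcongr
  have hM0 (h : lam < a * 1) : (Set.ncard {p : ℤ × ℤ | 1 ≤ p.1 ∧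
      (p.2 : ℝ) ^ 2 + a ^ 2 * (p.1 : ℝ) ^ 2 ≤ lam ^ 2} : ℝ) < (1 - r ^ 2) / 4 * lam ^ 2 := by
    refine (ncard_halfEllipse_le a lam ha hlam0 0 (by simpa using h)).trans_lt ?_
    have : 0 < 1 - r ^ 2 := by nlinarith
    simp only [Finset.univ_eq_empty, Finset.sum_empty]
    positivity
  have hM1 (hr : 2 / 3 ≤ r) (h : lam < a * 2) : (Set.ncard {p : ℤ × ℤ | 1 ≤ p.1 ∧
      (p.2 : ℝ) ^ 2 + a ^ 2 * (p.1 : ℝ) ^ 2 ≤ lam ^ 2} : ℝ) < (1 - r ^ 2) / 4 * lam ^ 2 := by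
    rcases lt_or_ge lam (a * 1) with h' | h'
    · exact hM0 h'
    obtain ⟨hk, hA⟩ := hlower 0.81649 (2 / 3) (by norm_num) (by norm_num) (by norm_num) hr
    norm_num at hk hA
    refine ncard_halfEllipse_lt a _ lam ha hlam0 1 (by norm_num; linarith) (by simpa using h')
      ![0.936] ?_ ?_ ?_
    · simp; norm_num
    · simp; norm_num; linarith
    · simp; norm_num; linarith
  have hM2 (hr : 4 / 5 ≤ r) (h : lam < a * 3) : (Set.ncard {p : ℤ × ℤ | 1 ≤ p.1 ∧
      (p.2 : ℝ) ^ 2 + a ^ 2 * (p.1 : ℝ) ^ 2 ≤ lam ^ 2} : ℝ) < (1 - r ^ 2) / 4 * lam ^ 2 := by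
    rcases lt_or_ge lam (a * 2) with h' | h'
    · exact hM1 (by linarith) h'
    obtain ⟨hk, hA⟩ := hlower 0.8944 (4 / 5) (by norm_num) (by norm_num) (by norm_num) hr
    norm_num at hk hA
    refine ncard_halfEllipse_lt a _ lam ha hlam0 2 (by norm_num; linarith) (by simpa using h')
      ![2.15, 1.26] ?_ ?_ ?_
    · simp [Fin.forall_fin_succ]; norm_num
    · simp [Fin.sum_univ_succ]; norm_num; linarith
    · simp [Fin.sum_univ_succ]; norm_num; linarith
  have hM3 (hr : 17 / 20 ≤ r) (h : lam < a * 4) : (Set.ncard {p : ℤ × ℤ | 1 ≤ p.1 ∧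
      (p.2 : ℝ) ^ 2 + a ^ 2 * (p.1 : ℝ) ^ 2 ≤ lam ^ 2} : ℝ) < (1 - r ^ 2) / 4 * lam ^ 2 := by
    rcases lt_or_ge lam (a * 3) with h' | h'
    · exact hM2 (by linarith) h'
    obtain ⟨hk, hA⟩ := hlower 0.9219 (17 / 20) (by norm_num) (by norm_num) (by norm_num) hr
    norm_num at hk hA
    refine ncard_halfEllipse_lt a _ lam ha hlam0 3 (by norm_num; linarith) (by simpa using h')
      ![3.22, 2.71, 1.525] ?_ ?_ ?_
    · simp [Fin.forall_fin_succ]; norm_num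
    · simp [Fin.sum_univ_succ]; norm_num; linarith
    · simp [Fin.sum_univ_succ]; norm_num; linarith
  have hM4 (hr : 22 / 25 ≤ r) (h : lam < a * 5) : (Set.ncard {p : ℤ × ℤ | 1 ≤ p.1 ∧
      (p.2 : ℝ) ^ 2 + a ^ 2 * (p.1 : ℝ) ^ 2 ≤ lam ^ 2} : ℝ) < (1 - r ^ 2) / 4 * lam ^ 2 := by
    rcases lt_or_ge lam (a * 4) with h' | h'
    · exact hM3 (by linarith) h'
    obtain ⟨hk, hA⟩ := hlower 0.938 (22 / 25) (by norm_num) (by norm_num) (by norm_num) hr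
    norm_num at hk hA
    refine ncard_halfEllipse_lt a _ lam ha hlam0 4 (by norm_num; linarith) (by simpa using h')
      ![4.25, 3.88, 3.17, 1.742] ?_ ?_ ?_
    · simp [Fin.forall_fin_succ]; norm_num
    · simp [Fin.sum_univ_succ]; norm_num; linarith
    · simp [Fin.sum_univ_succ]; norm_num; linarith
  have hη (k : ℝ) : k * π * √r / (1 - r) = a * k := by rw [ha_def]; ring
  unfold etaII at hlam
  split_ifs at hlam with c1 c2 c3 c4
  · exact hM0 (by rwa [← ha_def, ← mul_one a] at hlam)
  all_goals rw [hη] at hlam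
  · exact hM1 (by linarith) hlam
  · exact hM2 (by linarith) hlam
  · exact hM3 (by linarith) hlam
  · exact hM4 (by linarith) hlam
end

section
/- Let λ > 0. Then 2·T(G_λ + 1/4, 0, ⌊λ⌋+1) < λ²/4 − ⌊ω₀λ⌋/2, where ω₀ = √3/(2π) − 1/6. -/
open Real Set

/-- The constant `ω₀ = √3/(2π) − 1/6`. -/
noncomputable def omega0 : ℝ := Real.sqrt 3 / (2 * π) - 1 / 6

theorem funG_eq {lam : ℝ} (hlam : 0 < lam) (z : ℝ) :
    funG lam z = (√(lam ^ 2 - z ^ 2) - z * arccos (z / lam)) / π := by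
  unfold funG
  split_ifs with h
  · rfl
  · push Not at h
    rw [Real.sqrt_eq_zero_of_nonpos (by nlinarith),
      arccos_of_one_le ((one_le_div hlam).2 h.le)]
    simp

theorem continuous_funG {lam : ℝ} (hlam : 0 < lam) : Continuous (funG lam) := by
  rw [funext (funG_eq hlam)]
  have := Real.continuous_arccos
  fun_prop

/-- The graph of `sin` on `[0, π]` lies below each of its tangent lines. -/
theorem sin_le_tangent {a b : ℝ} (ha : a ∈ Icc 0 π) (hb : b ∈ Icc 0 π) :
    sin b ≤ sin a + cos a * (b - a) := by
  have hc := strictConcaveOn_sin_Icc.concaveOn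
  rcases lt_trichotomy a b with h | rfl | h
  · have := hc.slope_le_of_hasDerivAt ha hb h (hasDerivAt_sin a)
    rw [slope_def_field, div_le_iff₀ (sub_pos.2 h)] at this
    linarith
  · simp
  · have := hc.le_slope_of_hasDerivAt hb ha h (hasDerivAt_sin a)
    rw [slope_def_field, le_div_iff₀ (sub_pos.2 h)] at this
    linarith

theorem sqrt_sq_sub_sq {lam : ℝ} (hlam : 0 < lam) (z : ℝ) :
    √(lam ^ 2 - z ^ 2) = lam * sin (arccos (z / lam)) := by
  rw [sin_arccos, ← Real.sqrt_sq hlam.le, ← Real.sqrt_mul (sq_nonneg _), Real.sqrt_sq hlam.le]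
  congr 1
  field_simp

/-- `funG lam` lies above each of its tangent lines on `[0, lam]`. -/
theorem funG_ge_tangent {lam w z : ℝ} (hlam : 0 < lam)
    (hz : z ∈ Icc 0 lam) :
    funG lam w + arccos (w / lam) / π * (w - z) ≤ funG lam z := by
  have hcos : lam * cos (arccos (z / lam)) = z := by
    rw [cos_arccos (by linarith [div_nonneg hz.1 hlam.le]) ((div_le_one hlam).2 hz.2)]
    field_simp
  have hs := sin_le_tangent (a := arccos (z / lam)) (b := arccos (w / lam))
    ⟨arccos_nonneg _, arccos_le_pi _⟩ ⟨arccos_nonneg _, arccos_le_pi _⟩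
  have hs' := mul_le_mul_of_nonneg_left hs hlam.le
  rw [funG_eq hlam, funG_eq hlam, sqrt_sq_sub_sq hlam, sqrt_sq_sub_sq hlam, div_mul_eq_mul_div,
    ← add_div]
  gcongr
  have : lam * (cos (arccos (z / lam)) * (arccos (w / lam) - arccos (z / lam)))
      = z * (arccos (w / lam) - arccos (z / lam)) := by rw [← mul_assoc, hcos]
  linarith

theorem funG_self {lam : ℝ} (hlam : 0 < lam) : funG lam lam = 0 := by
  simp [funG_eq hlam, hlam.ne']

theorem funG_nonneg {lam z : ℝ} (hlam : 0 < lam) (hz : z ∈ Icc 0 lam) : 0 ≤ funG lam z := by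
  simpa [funG_self hlam, hlam.ne'] using funG_ge_tangent (w := lam) hlam hz

theorem funG_strictAntiOn {lam : ℝ} (hlam : 0 < lam) : StrictAntiOn (funG lam) (Icc 0 lam) := by
  intro w hw z hz h
  rcases hz.2.eq_or_lt with rfl | hlt
  · have h₁ := funG_ge_tangent hlam (w := (w + z) / 2) hw
    have h₂ := funG_nonneg hlam (z := (w + z) / 2) ⟨by linarith [hw.1], by linarith⟩
    have : 0 < arccos ((w + z) / 2 / z) / π * ((w + z) / 2 - w) := by
      refine mul_pos (div_pos (arccos_pos.2 ((div_lt_one hlam).2 (by linarith))) pi_pos) ?_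
      linarith
    rw [funG_self hlam]
    linarith
  · have h₁ := funG_ge_tangent (w := z) hlam hw
    have : 0 < arccos (z / lam) / π * (z - w) :=
      mul_pos (div_pos (arccos_pos.2 ((div_lt_one hlam).2 hlt)) pi_pos) (by linarith)
    linarith

theorem funG_half {lam : ℝ} (hlam : 0 < lam) : funG lam (lam / 2) = omega0 * lam := by
  have h1 : arccos (lam / 2 / lam) = π / 3 := by
    refine arccos_eq_of_eq_cos (by positivity) (by linarith [pi_pos]) ?_
    rw [cos_pi_div_three]
    field_simp
  rw [funG_eq hlam, sqrt_sq_sub_sq hlam, h1, sin_pi_div_three, omega0]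
  field_simp
  ring

theorem integral_funG {lam : ℝ} (hlam : 0 < lam) : ∫ z in 0..lam, funG lam z = lam ^ 2 / 8 := by
  have hc := Real.continuous_arccos
  have hs := Real.continuous_arcsin
  rw [intervalIntegral.integral_eq_sub_of_hasDerivAt_of_le (f := fun z => (3 / 4 *
    (z * √(lam ^ 2 - z ^ 2)) + lam ^ 2 / 4 * arcsin (z / lam)
      - z ^ 2 / 2 * arccos (z / lam)) / π) hlam.le (by fun_prop) ?_
    ((continuous_funG hlam).intervalIntegrable _ _)]
  · simp [hlam.ne']
    field_simp
    norm_num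
  · intro z hz
    have hpos : 0 < lam ^ 2 - z ^ 2 := by nlinarith [hz.1, hz.2]
    have h0 := div_pos hz.1 hlam
    have h1 := (div_lt_one hlam).2 hz.2
    have hd : HasDerivAt (fun z : ℝ => z / lam) (1 / lam) z := (hasDerivAt_id z).div_const lam
    have hsq : HasDerivAt (fun z : ℝ => z ^ 2) (2 * z) z := by simpa using hasDerivAt_pow 2 z
    have hr := (hsq.const_sub (lam ^ 2)).sqrt hpos.ne'
    have ha := (hasDerivAt_arcsin (by linarith) h1.ne).comp z hd
    have hb := (hasDerivAt_arccos (by linarith) h1.ne).comp z hd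
    have := ((((hasDerivAt_id z).mul hr).const_mul (3 / 4)).add (ha.const_mul (lam ^ 2 / 4))).sub
      ((hsq.div_const 2).mul hb) |>.div_const π
    refine this.congr_deriv ?_
    have hroot : √(1 - (z / lam) ^ 2) = √(lam ^ 2 - z ^ 2) / lam := by
      rw [sqrt_sq_sub_sq hlam, sin_arccos]
      field_simp
    have hne := (Real.sqrt_pos.2 hpos).ne'
    have hsqr := Real.sq_sqrt hpos.le
    rw [funG_eq hlam, hroot]
    simp only [id, Function.comp]
    generalize √(lam ^ 2 - z ^ 2) = r at *
    have hl : lam ^ 2 = r ^ 2 + z ^ 2 := by linarith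
    field_simp
    rw [hl]
    ring

/-- A function above the line of slope `-σ` through `(q, 0)` has at least the area of the
truncated line between the heights `0` and `1`. -/
theorem integral_clamp_ge {f : ℝ → ℝ} (hf : Continuous f) {L q σ : ℝ} (hσ : 0 < σ) (hq : 0 ≤ q)
    (hqL : q ≤ L) (h : ∀ z ∈ Icc 0 L, σ * (q - z) ≤ f z) :
    max 0 (q - 1 / σ) + σ * (q - max 0 (q - 1 / σ)) ^ 2 / 2 ≤
      ∫ z in 0..L, max 0 (min 1 (f z)) := by
  set p := max 0 (q - 1 / σ)
  have hσ' : 0 < 1 / σ := by positivity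
  have hp0 : 0 ≤ p := le_max_left _ _
  have hpq : p ≤ q := max_le hq (by linarith)
  have h_integ : ∀ a b, IntervalIntegrable (fun z => max 0 (min 1 (f z)))
      MeasureTheory.volume a b := fun a b =>
    Continuous.intervalIntegrable (by fun_prop) a b
  rw [← intervalIntegral.integral_add_adjacent_intervals (h_integ 0 q) (h_integ q L),
    ← intervalIntegral.integral_add_adjacent_intervals (h_integ 0 p) (h_integ p q)]
  have h1 : p ≤ ∫ z in 0..p, max 0 (min 1 (f z)) := by
    have := intervalIntegral.integral_mono_on_of_le_Ioo hp0
      (f := fun _ => (1 : ℝ)) (by simp) (h_integ 0 p) (fun z hz => ?_)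
    · simpa using this
    · have hz2 : z < q - 1 / σ := (lt_max_iff.1 hz.2).resolve_left (not_lt.2 hz.1.le)
      have := mul_le_mul_of_nonneg_left (a := σ) (show 1 / σ ≤ q - z by linarith) hσ.le
      rw [mul_one_div_cancel hσ.ne'] at this
      refine le_max_of_le_right (le_min le_rfl (this.trans (h z ⟨hz.1.le, ?_⟩)))
      linarith [hz.2]
  have h2 : σ * (q - p) ^ 2 / 2 ≤ ∫ z in p..q, max 0 (min 1 (f z)) := by
    have := intervalIntegral.integral_mono_on hpq (f := fun z => σ * (q - z))
      (Continuous.intervalIntegrable (by fun_prop) _ _) (h_integ p q) (fun z hz => ?_)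
    · refine le_trans (le_of_eq ?_) this
      rw [intervalIntegral.integral_const_mul, intervalIntegral.integral_sub (by simp) (by simp),
        intervalIntegral.integral_const, integral_id, smul_eq_mul]
      ring
    · have := mul_le_mul_of_nonneg_left (a := σ) (show q - z ≤ 1 / σ by
        linarith [hz.1, le_max_right 0 (q - 1 / σ)]) hσ.le
      rw [mul_one_div_cancel hσ.ne'] at this
      exact le_max_of_le_right (le_min this (h z ⟨hp0.trans hz.1, hz.2.trans hqL⟩))
  have h3 : 0 ≤ ∫ z in q..L, max 0 (min 1 (f z)) :=
    intervalIntegral.integral_nonneg hqL fun z _ => le_max_left _ _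
  linarith

theorem sum_clamp_le {y : ℝ} (hy : 0 ≤ y) (M : ℕ) :
    ∑ n ∈ Finset.range M, max 0 (min 1 (y - n)) ≤ y := by
  suffices ∑ n ∈ Finset.range M, max 0 (min 1 (y - n)) = min y M from this ▸ min_le_left _ _
  induction M with
  | zero => simp [hy]
  | succ k ih =>
    rw [Finset.sum_range_succ, ih]
    push_cast
    grind

/-- The layer of `funG lam` between the heights `n` and `n + 1` has area larger than the abscissa
of the point of the graph at height `n + 3 / 4`, plus `1 / 2`, or `3 / 4` in low layers. -/
theorem exists_layer_bound {lam : ℝ} (hlam : 0 < lam) (n : ℕ) (hn : n + 3 / 4 ≤ funG lam 0) :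
    ∃ w ∈ Icc 0 lam, (∀ z ∈ Icc 0 lam, n + 3 / 4 ≤ funG lam z → z ≤ w) ∧
      w + 1 / 2 + (if n + 1 ≤ omega0 * lam then 1 / 4 else 0) <
        ∫ z in 0..lam, max 0 (min 1 (funG lam z - n)) := by
  obtain ⟨w, hw, hwn⟩ := intermediate_value_Icc' hlam.le (continuous_funG hlam).continuousOn
    (show (n : ℝ) + 3 / 4 ∈ Icc (funG lam lam) (funG lam 0) from
      ⟨by rw [funG_self hlam]; positivity, hn⟩)
  refine ⟨w, hw, fun z hz hzn => ?_, ?_⟩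
  · rw [← hwn] at hzn
    exact (funG_strictAntiOn hlam).le_iff_ge hw hz |>.1 hzn
  have hwlt : w < lam := by
    refine hw.2.lt_of_ne ?_
    rintro rfl
    rw [funG_self hlam] at hwn
    linarith [n.cast_nonneg (α := ℝ)]
  set σ := arccos (w / lam) / π with hσdef
  have hσ : 0 < σ := div_pos (arccos_pos.2 ((div_lt_one hlam).2 hwlt)) pi_pos
  have htan : ∀ z ∈ Icc 0 lam, n + 3 / 4 + σ * (w - z) ≤ funG lam z := fun z hz =>
    hwn ▸ funG_ge_tangent hlam hz
  have hσq : σ * (3 / 4 / σ) = 3 / 4 := by field_simp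
  have hend := htan lam ⟨hlam.le, le_rfl⟩
  rw [funG_self hlam] at hend
  have hqL : w + 3 / 4 / σ ≤ lam := by
    have : σ * (w + 3 / 4 / σ - lam) ≤ 0 := by
      rw [show σ * (w + 3 / 4 / σ - lam) = σ * (3 / 4 / σ) + σ * (w - lam) by ring, hσq]
      linarith [n.cast_nonneg (α := ℝ)]
    linarith [nonpos_of_mul_nonpos_right this hσ]
  have hcl := integral_clamp_ge (f := fun z => funG lam z - n)
    ((continuous_funG hlam).sub continuous_const) hσ
    (by have := hw.1; positivity) hqL (fun z hz => by
      have := htan z hz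
      rw [show σ * (w + 3 / 4 / σ - z) = σ * (3 / 4 / σ) + σ * (w - z) by ring, hσq]
      linarith)
  refine lt_of_lt_of_le ?_ hcl
  set p := max 0 (w + 3 / 4 / σ - 1 / σ) with hp
  have hid : p + σ * (w + 3 / 4 / σ - p) ^ 2 / 2
      = w + 1 / 4 / σ + σ / 2 * (w + 3 / 4 / σ - p - 1 / σ) ^ 2 := by
    field_simp
    ring
  rw [hid]
  have hsq : 0 ≤ σ / 2 * (w + 3 / 4 / σ - p - 1 / σ) ^ 2 := by positivity
  split_ifs with hlow
  · have hlt : lam / 2 < w := by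
      rw [← funG_half hlam] at hlow
      refine ((funG_strictAntiOn hlam).lt_iff_gt hw ⟨by linarith, by linarith⟩).1 ?_
      linarith
    have hσ3 : σ < 1 / 3 := by
      have h2 : arccos (w / lam) < arccos (1 / 2) :=
        arccos_lt_arccos (by norm_num) ((lt_div_iff₀ hlam).2 (by linarith))
          ((div_le_one hlam).2 hw.2)
      rw [arccos_eq_of_eq_cos (y := π / 3) (by positivity) (by linarith [pi_pos])
        cos_pi_div_three.symm] at h2
      rw [hσdef, div_lt_iff₀ pi_pos]
      linarith
    have : 3 / 4 < 1 / 4 / σ := (lt_div_iff₀ hσ).2 (by linarith)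
    linarith
  · rcases hw.1.eq_or_lt with h0 | h0
    · have hσ2 : σ = 1 / 2 := by
        rw [hσdef, ← h0, zero_div, arccos_zero]
        field_simp
      have hp0 : p = 0 := by
        rw [hp, hσ2, ← h0]
        norm_num
      rw [hp0, hσ2, ← h0]
      norm_num
    · have hσ2 : σ < 1 / 2 := by
        have := arccos_lt_pi_div_two.2 (div_pos h0 hlam)
        rw [hσdef, div_lt_iff₀ pi_pos]
        linarith
      have : 1 / 2 < 1 / 4 / σ := (lt_div_iff₀ hσ).2 (by linarith)
      linarith

theorem floor_le_card_filter {y : ℝ} (hy : 0 ≤ y) {M : ℕ} (hM : ⌊y⌋ ≤ M) :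
    (⌊y⌋ : ℝ) ≤ ((Finset.range M).filter fun n : ℕ => (n : ℝ) + 1 ≤ y).card := by
  have h0 : 0 ≤ ⌊y⌋ := Int.floor_nonneg.2 hy
  have hle : ⌊y⌋.toNat ≤ ((Finset.range M).filter fun n : ℕ => (n : ℝ) + 1 ≤ y).card := by
    rw [← Finset.card_range ⌊y⌋.toNat]
    refine Finset.card_le_card fun n hn => ?_
    rw [Finset.mem_range] at hn
    refine Finset.mem_filter.2 ⟨Finset.mem_range.2 (by omega), ?_⟩
    have h : (n : ℤ) + 1 ≤ ⌊y⌋ := by omega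
    exact_mod_cast Int.le_floor.1 h
  calc (⌊y⌋ : ℝ) = ((⌊y⌋.toNat : ℤ) : ℝ) := by rw [Int.toNat_of_nonneg h0]
    _ ≤ _ := by exact_mod_cast hle

theorem card_filter_le {w : ℝ} (hw : 0 ≤ w) (K : ℤ) :
    (((Finset.Ioo 0 K).filter fun m : ℤ => (m : ℝ) ≤ w).card : ℝ) ≤ w := by
  have h : ((Finset.Ioo 0 K).filter fun m : ℤ => (m : ℝ) ≤ w).card ≤ ⌊w⌋.toNat := by
    have hsub : ((Finset.Ioo 0 K).filter fun m : ℤ => (m : ℝ) ≤ w) ⊆ Finset.Ioc 0 ⌊w⌋ := by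
      intro m hm
      rw [Finset.mem_filter, Finset.mem_Ioo] at hm
      exact Finset.mem_Ioc.2 ⟨hm.1.1, Int.le_floor.2 hm.2⟩
    simpa using Finset.card_le_card hsub
  exact (Nat.cast_le.2 h).trans (Int.floor_toNat w ▸ Nat.floor_le hw)

theorem disk_improved_trapSum (lam : ℝ) (hlam : 0 < lam) :
    2 * trapSum (fun z => funG lam z + 1 / 4) 0 (⌊lam⌋ + 1) <
      lam ^ 2 / 4 - (⌊omega0 * lam⌋ : ℝ) / 2 := by
  have hmem0 : (0 : ℝ) ∈ Icc 0 lam := ⟨le_rfl, hlam.le⟩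
  have hg0 := funG_nonneg hlam hmem0
  have hanti := funG_strictAntiOn hlam
  obtain ⟨M, hM⟩ := Int.eq_ofNat_of_zero_le (Int.floor_nonneg.2 (by linarith :
    0 ≤ funG lam 0 + 1 / 4))
  have hMle : (M : ℝ) ≤ funG lam 0 + 1 / 4 := by
    have := Int.floor_le (funG lam 0 + 1 / 4)
    rw [hM] at this
    exact_mod_cast this
  have hlayer : ∀ n ∈ Finset.range M, (n : ℝ) + 3 / 4 ≤ funG lam 0 := by
    intro n hn
    have : (n : ℝ) + 1 ≤ M := by exact_mod_cast Finset.mem_range.1 hn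
    linarith
  choose! w hw hwtop hwint using fun n (hn : n ∈ Finset.range M) =>
    exists_layer_bound hlam n (hlayer n hn)
  have hhalf : omega0 * lam < funG lam 0 := by
    rw [← funG_half hlam]
    exact hanti hmem0 ⟨by linarith, by linarith⟩ (by linarith)
  have hω0 : 0 ≤ omega0 * lam := by
    rw [← funG_half hlam]
    exact funG_nonneg hlam ⟨by linarith, by linarith⟩
  have hωM : ⌊omega0 * lam⌋ ≤ M := hM ▸ Int.floor_mono (by linarith)
  have hgain := floor_le_card_filter hω0 hωM
  have hend : ⌊funG lam ((⌊lam⌋ + 1 : ℤ) : ℝ) + 1 / 4⌋ = 0 := by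
    have : ¬ ((⌊lam⌋ + 1 : ℤ) : ℝ) ≤ lam := by
      push_cast
      exact not_le.2 (Int.lt_floor_add_one lam)
    rw [funG, if_neg this]
    norm_num
  have hsum : ∑ m ∈ Finset.Ioo 0 (⌊lam⌋ + 1), (⌊funG lam (m : ℝ) + 1 / 4⌋ : ℝ)
      ≤ ∑ n ∈ Finset.range M, w n := by
    calc ∑ m ∈ Finset.Ioo 0 (⌊lam⌋ + 1), (⌊funG lam (m : ℝ) + 1 / 4⌋ : ℝ)
        ≤ ∑ m ∈ Finset.Ioo 0 (⌊lam⌋ + 1), ∑ n ∈ Finset.range M,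
            if (m : ℝ) ≤ w n then (1 : ℝ) else 0 := by
          refine Finset.sum_le_sum fun m hm => ?_
          rw [Finset.mem_Ioo] at hm
          have hmI : (m : ℝ) ∈ Icc 0 lam :=
            ⟨by exact_mod_cast hm.1.le, Int.le_floor.1 (by omega)⟩
          refine (floor_le_card_filter (by linarith [funG_nonneg hlam hmI])
            ((Int.floor_mono (add_le_add_left (hanti.antitoneOn hmem0 hmI hmI.1) _)).trans
              hM.le)).trans ?_
          rw [← Finset.sum_boole]
          refine Finset.sum_le_sum fun n hn => ?_
          have := hwtop n hn m hmI
          split_ifs with h1 h2 <;> first | exact absurd (this (by linarith)) h2 | norm_num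
      _ = ∑ n ∈ Finset.range M,
            ((((Finset.Ioo 0 (⌊lam⌋ + 1)).filter fun m : ℤ => (m : ℝ) ≤ w n).card : ℕ) : ℝ) := by
          rw [Finset.sum_comm]
          simp only [Finset.sum_boole]
      _ ≤ _ := Finset.sum_le_sum fun n hn => card_filter_le (hw n hn).1 _
  have h_integ : ∑ n ∈ Finset.range M, ∫ z in 0..lam, max 0 (min 1 (funG lam z - n))
      ≤ lam ^ 2 / 8 := by
    have hc := continuous_funG hlam
    rw [← intervalIntegral.integral_finsetSum fun n _ =>
      Continuous.intervalIntegrable (by fun_prop) _ _, ← integral_funG hlam]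
    exact intervalIntegral.integral_mono_on hlam.le
      (Continuous.intervalIntegrable (by fun_prop) _ _) (hc.intervalIntegrable _ _)
      fun z hz => sum_clamp_le (funG_nonneg hlam hz) M
  have htotal : ∑ n ∈ Finset.range M,
      (w n + 1 / 2 + if (n : ℝ) + 1 ≤ omega0 * lam then 1 / 4 else 0) < lam ^ 2 / 8 := by
    rcases M.eq_zero_or_pos with rfl | hpos
    · simpa using by positivity
    · exact (Finset.sum_lt_sum_of_nonempty ⟨0, Finset.mem_range.2 hpos⟩ hwint).trans_le h_integ
  rw [Finset.sum_add_distrib, Finset.sum_add_distrib, ← Finset.sum_filter, Finset.sum_const,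
    Finset.sum_const, Finset.card_range, nsmul_eq_mul, nsmul_eq_mul] at htotal
  have htrap : trapSum (fun z => funG lam z + 1 / 4) 0 (⌊lam⌋ + 1)
      ≤ (M : ℝ) / 2 + ∑ n ∈ Finset.range M, w n := by
    simp only [trapSum, hend, Int.cast_zero, hM]
    simpa using hsum
  linarith
end
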